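/- arXiv:2510.18450 — 2 statements merged into one kernel-verified Lean document; each statement's English description precedes it below -/
import Mathlib

section
/- Let n ≥ 3, m ≥ 2 and c = 1, fix ω_0 ∈ S^{n−1} and δ > 0, and let f ∈ C_c^∞(ℝ^{1+n}; S^m) satisfy j_g f = 0. If L̃^{m,k} f((t,x), ω) = 0 for all k = 0,1,…,m, all (t,x) ∈ ℝ^{1+n} and all ω ∈ B_n(ω_0, δ), then f = 0. -/
open MeasureTheory Finset

noncomputable section

/-- The light direction `ω̃ = (c, ω) ∈ ℝ^{1+n}`. -/
def ld (n : ℕ) (c : ℝ) (ω : Fin n → ℝ) : Fin (n + 1) → ℝ := Fin.cons c ω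

/-- The `k`-th momentum light ray transform of a rank-`m` symmetric tensor field,
`L^{m,k} f((t,x), ω) = Σ ω̃_{i_1}⋯ω̃_{i_m} ∫ s^k f_{i_1…i_m}((t,x) + s ω̃) ds`. -/
def mlrt (n m : ℕ) (c : ℝ) (k : ℕ)
    (f : (Fin m → Fin (n + 1)) → (Fin (n + 1) → ℝ) → ℂ)
    (x : Fin (n + 1) → ℝ) (ω : Fin n → ℝ) : ℂ :=
  ∑ i : Fin m → Fin (n + 1),
    (∏ j, (ld n c ω (i j) : ℂ)) *
      ∫ s : ℝ, (s : ℂ) ^ k * f i (x + s • ld n c ω)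

/-- A tensor field is symmetric: invariant under permutations of its indices. -/
def IsSymmF (n m : ℕ) (f : (Fin m → Fin (n + 1)) → (Fin (n + 1) → ℝ) → ℂ) : Prop :=
  ∀ (σ : Equiv.Perm (Fin m)) (i : Fin m → Fin (n + 1)), f (i ∘ σ) = f i

/-- All components are smooth and compactly supported. -/
def IsCc (n m : ℕ) (f : (Fin m → Fin (n + 1)) → (Fin (n + 1) → ℝ) → ℂ) : Prop :=
  ∀ i, ContDiff ℝ (⊤ : ℕ∞) (f i) ∧ HasCompactSupport (f i)

/-- `ω ∈ S^{n-1}` (Euclidean unit sphere). -/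
def onSphere (n : ℕ) (ω : Fin n → ℝ) : Prop := ∑ i, ω i ^ 2 = 1

/-- `ω ∈ B_n(ω₀, δ)`: on the sphere and at Euclidean distance `< δ` from `ω₀`. -/
def inBall (n : ℕ) (ω₀ : Fin n → ℝ) (δ : ℝ) (ω : Fin n → ℝ) : Prop :=
  onSphere n ω ∧ ∑ i, (ω i - ω₀ i) ^ 2 < δ ^ 2

/-- The trace `j_g f` (with `g = diag(−1,1,…,1)`) of a symmetric `(m+2)`-tensor field:
`(j_g f)_{i_1…i_m} = −f_{i_1…i_m 0 0} + Σ_{p=1}^n f_{i_1…i_m p p}`. -/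
def jgF (n m : ℕ)
    (f : (Fin (m + 2) → Fin (n + 1)) → (Fin (n + 1) → ℝ) → ℂ)
    (i : Fin m → Fin (n + 1)) (x : Fin (n + 1) → ℝ) : ℂ :=
  -f (Fin.snoc (Fin.snoc i 0) 0) x +
    ∑ p : Fin n, f (Fin.snoc (Fin.snoc i p.succ) p.succ) x

/-! ### Part 1: algebra of symmetric trace-free tensors -/

/-- Evaluation of a tensor on the `M`-th power of a vector. -/
def ev (N M : ℕ) (T : (Fin M → Fin N) → ℂ) (η : Fin N → ℝ) : ℂ :=
  ∑ i : Fin M → Fin N, (∏ j, (η (i j) : ℂ)) * T i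

/-- Contraction of the first slot with a basis vector. -/
def ct {N M : ℕ} (T : (Fin (M + 1) → Fin N) → ℂ) (a : Fin N) : (Fin M → Fin N) → ℂ :=
  fun i => T (Fin.cons a i)

/-- Symmetric tensors. -/
def Sy {N M : ℕ} (T : (Fin M → Fin N) → ℂ) : Prop :=
  ∀ (σ : Equiv.Perm (Fin M)) (i : Fin M → Fin N), T (i ∘ σ) = T i

/-- Trace-free tensors. -/
def TF {n : ℕ} : {M : ℕ} → ((Fin M → Fin (n + 1)) → ℂ) → Prop
  | 0, _ => True
  | 1, _ => True
  | _ + 2, T => ∀ i, -ct (ct T 0) 0 i + ∑ p : Fin n, ct (ct T p.succ) p.succ i = 0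

/-- Partial derivative of `ev`. -/
def dv (N : ℕ) : (M : ℕ) → ((Fin M → Fin N) → ℂ) → Fin N → (Fin N → ℝ) → ℂ
  | 0, _, _, _ => 0
  | K + 1, T, b, η => (K + 1 : ℂ) * ev N K (ct T b) η

lemma ev_succ (N M : ℕ) (T : (Fin (M + 1) → Fin N) → ℂ) (η : Fin N → ℝ) :
    ev N (M + 1) T η = ∑ a, (η a : ℂ) * ev N M (ct T a) η := by
  unfold ev ct
  rw [← (Fin.consEquiv (fun _ : Fin (M + 1) => Fin N)).sum_comp, Fintype.sum_prod_type]
  refine Finset.sum_congr rfl fun a _ => ?_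
  rw [Finset.mul_sum]
  refine Finset.sum_congr rfl fun i _ => ?_
  simp [Fin.consEquiv, Fin.prod_univ_succ, mul_assoc]

lemma ev_smul (N M : ℕ) (T : (Fin M → Fin N) → ℂ) (w : ℝ) (η : Fin N → ℝ) :
    ev N M T (w • η) = (w : ℂ) ^ M * ev N M T η := by
  unfold ev
  rw [Finset.mul_sum]
  refine Finset.sum_congr rfl fun i _ => ?_
  simp [Finset.prod_mul_distrib, mul_assoc]

lemma Sy.ct {N M : ℕ} {T : (Fin (M + 1) → Fin N) → ℂ} (h : Sy T) (a : Fin N) :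
    Sy (ct T a) := by
  intro σ i
  unfold _root_.ct
  rw [← h (Equiv.Perm.decomposeFin.symm (0, σ)) (Fin.cons a i)]
  congr 1
  funext j
  refine Fin.cases ?_ (fun j => ?_) j <;> simp

lemma Sy.ct_comm {N M : ℕ} {T : (Fin (M + 2) → Fin N) → ℂ} (h : Sy T) (a b : Fin N) :
    _root_.ct (_root_.ct T a) b = _root_.ct (_root_.ct T b) a := by
  funext i
  unfold _root_.ct
  rw [← h (Equiv.swap 0 1) (Fin.cons a (Fin.cons b i))]
  congr 1
  funext j
  refine Fin.cases ?_ (fun j => Fin.cases ?_ (fun j => ?_) j) j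
  · simp only [Function.comp, Equiv.swap_apply_left, Fin.cons_zero]
    rfl
  · have : (Fin.succ 0 : Fin (M + 2)) = 1 := rfl
    simp only [Function.comp, this, Equiv.swap_apply_right, Fin.cons_zero]
    rfl
  · simp only [Function.comp]
    rw [Equiv.swap_apply_of_ne_of_ne]
    · simp
    · exact Fin.succ_ne_zero _
    · intro h
      have := congrArg Fin.val h
      simp at this

lemma Sy.dv_comm {N M : ℕ} {T : (Fin (M + 1) → Fin N) → ℂ} (h : Sy T) (a b : Fin N)
    (η : Fin N → ℝ) :
    dv N M (_root_.ct T a) b η = dv N M (_root_.ct T b) a η := by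
  cases M with
  | zero => rfl
  | succ K => simp only [dv]; rw [h.ct_comm]

lemma dv_euler {N M : ℕ} (T : (Fin M → Fin N) → ℂ) (η : Fin N → ℝ) :
    ∑ b, (η b : ℂ) * dv N M T b η = M * ev N M T η := by
  cases M with
  | zero => simp [dv]
  | succ K =>
    rw [ev_succ, Finset.mul_sum]
    refine Finset.sum_congr rfl fun a _ => ?_
    simp only [dv]; push_cast; ring

lemma TF.ct {n M : ℕ} {T : (Fin (M + 1) → Fin (n + 1)) → ℂ} (hs : Sy T) (h : TF T)
    (a : Fin (n + 1)) : TF (ct T a) := by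
  match M, T, hs, h with
  | 0, _, _, _ => trivial
  | 1, _, _, _ => trivial
  | K + 2, T, hs, h =>
    intro i
    have := h (Fin.cons a i)
    have key : ∀ p, _root_.ct (_root_.ct (_root_.ct T a) p) p i
        = _root_.ct (_root_.ct T p) p (Fin.cons a i) := by
      intro p
      rw [hs.ct_comm a p, (hs.ct p).ct_comm a p]
      rfl
    simpa only [key] using this

lemma dv_trace {n M : ℕ} {T : (Fin (M + 1) → Fin (n + 1)) → ℂ} (h : TF T)
    (η : Fin (n + 1) → ℝ) :
    -dv (n + 1) M (ct T 0) 0 η + ∑ p : Fin n, dv (n + 1) M (ct T p.succ) p.succ η = 0 := by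
  match M, T, h with
  | 0, _, _ => simp [dv]
  | K + 1, T, h =>
    simp only [dv, ev]
    rw [← Finset.mul_sum, ← mul_neg, ← mul_add, Finset.sum_comm, ← Finset.sum_neg_distrib,
      ← Finset.sum_add_distrib]
    refine mul_eq_zero_of_right _ (Finset.sum_eq_zero fun i _ => ?_)
    rw [← Finset.mul_sum, ← mul_neg, ← mul_add, h i, mul_zero]

lemma ev_hasDerivAt {N M : ℕ} {T : (Fin M → Fin N) → ℂ} (hs : Sy T)
    (γ : ℝ → Fin N → ℝ) (γ' : Fin N → ℝ) (u : ℝ)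
    (hγ : ∀ a, HasDerivAt (fun u => γ u a) (γ' a) u) :
    HasDerivAt (fun u => ev N M T (γ u)) (∑ b, (γ' b : ℂ) * dv N M T b (γ u)) u := by
  induction M with
  | zero =>
    simp only [ev, dv]
    simpa using hasDerivAt_const u _
  | succ K ih =>
    simp only [ev_succ]
    have h1 : ∀ a, HasDerivAt (fun u => (γ u a : ℂ) * ev N K (ct T a) (γ u))
        ((γ' a : ℂ) * ev N K (ct T a) (γ u)
          + (γ u a : ℂ) * ∑ b, (γ' b : ℂ) * dv N K (ct T a) b (γ u)) u :=
      fun a => ((hγ a).ofReal_comp).mul (ih (hs.ct a))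
    have h2 := HasDerivAt.fun_sum (u := Finset.univ) (fun a _ => h1 a)
    refine h2.congr_deriv (Eq.symm ?_)
    rw [Finset.sum_add_distrib]
    have : ∑ a, (γ u a : ℂ) * ∑ b, (γ' b : ℂ) * dv N K (ct T a) b (γ u)
        = ∑ b, (γ' b : ℂ) * (K * ev N K (ct T b) (γ u)) := by
      simp_rw [Finset.mul_sum]
      rw [Finset.sum_comm]
      refine Finset.sum_congr rfl fun b _ => ?_
      rw [← dv_euler, Finset.mul_sum]
      refine Finset.sum_congr rfl fun a _ => ?_
      rw [hs.dv_comm]; ring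
    rw [this, ← Finset.sum_add_distrib]
    refine Finset.sum_congr rfl fun b _ => ?_
    simp only [dv]; ring

/-- The conic on the null cone. -/
def cv (n : ℕ) (ω v : Fin n → ℝ) (u : ℝ) : Fin (n + 1) → ℝ :=
  Fin.cons (1 + (∑ p, v p ^ 2) * u ^ 2)
    (fun p => (1 - (∑ p, v p ^ 2) * u ^ 2) * ω p + 2 * u * v p)

lemma cv_pos (n : ℕ) (v : Fin n → ℝ) (u : ℝ) : 0 < 1 + (∑ p, v p ^ 2) * u ^ 2 := by
  positivity

lemma cv_eq (n : ℕ) (ω v : Fin n → ℝ) (u : ℝ) :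
    cv n ω v u = (1 + (∑ p, v p ^ 2) * u ^ 2) •
      ld n 1 (fun p => (1 + (∑ p, v p ^ 2) * u ^ 2)⁻¹ *
        ((1 - (∑ p, v p ^ 2) * u ^ 2) * ω p + 2 * u * v p)) := by
  have := (cv_pos n v u).ne'
  funext a
  refine Fin.cases ?_ (fun p => ?_) a
  · simp [cv, ld]
  · simp [cv, ld]
    field_simp

lemma cv_zero (n : ℕ) (ω v : Fin n → ℝ) : cv n ω v 0 = ld n 1 ω := by
  simp [cv, ld]

lemma cv_ball (n : ℕ) (ω₀ ω v : Fin n → ℝ) (δ : ℝ) (hω : inBall n ω₀ δ ω)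
    (hv : ∑ p, ω p * v p = 0) :
    ∀ᶠ u in nhds (0 : ℝ), inBall n ω₀ δ (fun p => (1 + (∑ p, v p ^ 2) * u ^ 2)⁻¹ *
        ((1 - (∑ p, v p ^ 2) * u ^ 2) * ω p + 2 * u * v p)) := by
  have hc : Continuous fun u : ℝ => ∑ i, ((1 + (∑ p, v p ^ 2) * u ^ 2)⁻¹ *
        ((1 - (∑ p, v p ^ 2) * u ^ 2) * ω i + 2 * u * v i) - ω₀ i) ^ 2 := by
    refine continuous_finsetSum _ fun i _ => ?_
    have : Continuous fun u : ℝ => (1 + (∑ p, v p ^ 2) * u ^ 2)⁻¹ :=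
      Continuous.inv₀ (by fun_prop) (fun u => (cv_pos n v u).ne')
    fun_prop
  have h0 := hc.tendsto 0
  have h1 : ∑ i, ((1 + (∑ p, v p ^ 2) * (0:ℝ) ^ 2)⁻¹ *
        ((1 - (∑ p, v p ^ 2) * (0:ℝ) ^ 2) * ω i + 2 * (0:ℝ) * v i) - ω₀ i) ^ 2 < δ ^ 2 := by
    simpa using hω.2
  filter_upwards [h0.eventually_lt_const h1] with u hu
  refine ⟨?_, hu⟩
  have hpos := (cv_pos n v u).ne'
  have h2 := hω.1
  unfold onSphere at h2 ⊢
  set c := ∑ p, v p ^ 2 with hcdef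
  have : ∀ i, ((1 + c * u ^ 2)⁻¹ * ((1 - c * u ^ 2) * ω i + 2 * u * v i)) ^ 2
     = (1 + c * u ^ 2)⁻¹ ^ 2 * ((1 - c * u ^ 2) ^ 2 * ω i ^ 2
        + 4 * u * (1 - c * u ^ 2) * (ω i * v i) + 4 * u ^ 2 * v i ^ 2) := fun i => by ring
  simp only [this]
  rw [← Finset.mul_sum, Finset.sum_add_distrib, Finset.sum_add_distrib, ← Finset.mul_sum,
    ← Finset.mul_sum, ← Finset.mul_sum, h2, hv, ← hcdef]
  field_simp
  ring

/-- Pure linear algebra: the first-order data vanish. -/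
lemma alg_zero (n M : ℕ) (hn : 3 ≤ n) (ω : Fin n → ℝ) (hω : onSphere n ω)
    (E0 : ℂ) (E : Fin n → ℂ) (S00 : ℂ) (S0 : Fin n → ℂ) (S : Fin n → Fin n → ℂ)
    (h1 : S00 + ∑ p, (ω p : ℂ) * S0 p = M * E0)
    (h1' : ∀ a, S0 a + ∑ p, (ω p : ℂ) * S a p = M * E a)
    (h2 : -S00 + ∑ p, S p p = 0)
    (h3 : E0 + ∑ p, (ω p : ℂ) * E p = 0)
    (h4 : ∀ v : Fin n → ℝ, ∑ p, ω p * v p = 0 → ∑ p, (v p : ℂ) * E p = 0)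
    (h5 : ∀ v : Fin n → ℝ, ∑ p, ω p * v p = 0 →
      2 * (∑ p, (v p : ℂ) ^ 2) * (E0 - ∑ p, (ω p : ℂ) * E p)
        + 4 * ∑ p, ∑ q, (v p : ℂ) * v q * S p q = 0) :
    E0 = 0 ∧ ∀ p, E p = 0 := by
  have hωc : ∑ p, (ω p : ℂ) ^ 2 = 1 := by exact_mod_cast hω
  let V : Fin n → Fin n → ℝ := fun k p => (if p = k then 1 else 0) - ω k * ω p
  have hV : ∀ k, ∑ p, ω p * V k p = 0 := by
    intro k
    simp only [V, mul_sub, Finset.sum_sub_distrib]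
    have : ∑ p, ω p * (ω k * ω p) = ω k * ∑ p, ω p ^ 2 := by
      rw [Finset.mul_sum]; exact Finset.sum_congr rfl fun p _ => by ring
    rw [this, show ∑ p, ω p ^ 2 = 1 from hω]
    simp
  have hVV : ∀ p q, ∑ k, (V k p : ℂ) * V k q = (if p = q then 1 else 0) - ω p * ω q := by
    intro p q
    have : ∀ k, (V k p : ℂ) * V k q = (if p = k then (if q = k then 1 else 0) else 0)
        - (if p = k then (ω k * ω q : ℂ) else 0) - (if q = k then (ω k * ω p : ℂ) else 0)
        + (ω p * ω q : ℂ) * (ω k : ℂ) ^ 2 := by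
      intro k
      simp only [V]
      push_cast
      split_ifs <;> simp <;> ring
    simp only [this, Finset.sum_add_distrib, Finset.sum_sub_distrib, ← Finset.mul_sum, hωc]
    simp [eq_comm]
    ring
  set e := ∑ p, (ω p : ℂ) * E p with he
  have hsum : ∑ k, (2 * (∑ p, (V k p : ℂ) ^ 2) * (E0 - e)
        + 4 * ∑ p, ∑ q, (V k p : ℂ) * V k q * S p q) = 0 :=
    Finset.sum_eq_zero fun k _ => h5 _ (hV k)
  rw [Finset.sum_add_distrib, ← Finset.sum_mul, ← Finset.mul_sum, ← Finset.mul_sum,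
    Finset.sum_comm] at hsum
  have e1 : ∑ p, ∑ k, (V k p : ℂ) ^ 2 = n - 1 := by
    have : ∀ p, ∑ k, (V k p : ℂ) ^ 2 = 1 - (ω p : ℂ) ^ 2 := by
      intro p
      have := hVV p p
      simp only [if_true] at this
      simpa only [sq] using this
    simp only [this, Finset.sum_sub_distrib, hωc]
    simp
  have e2 : ∑ k, ∑ p, ∑ q, (V k p : ℂ) * V k q * S p q
      = ∑ p, S p p - ∑ p, (ω p : ℂ) * ∑ q, (ω q : ℂ) * S p q := by
    rw [Finset.sum_comm, ← Finset.sum_sub_distrib]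
    refine Finset.sum_congr rfl fun p _ => ?_
    rw [Finset.sum_comm]
    simp only [← Finset.sum_mul, hVV, sub_mul, Finset.sum_sub_distrib]
    congr 1
    · simp
    · rw [Finset.mul_sum]; exact Finset.sum_congr rfl fun q _ => by ring
  rw [e1, e2] at hsum
  have e3 : ∑ p, (ω p : ℂ) * S0 p + ∑ p, (ω p : ℂ) * ∑ q, (ω q : ℂ) * S p q = M * e := by
    rw [he, Finset.mul_sum, ← Finset.sum_add_distrib]
    refine Finset.sum_congr rfl fun p _ => ?_
    rw [← mul_add, h1' p]; ring
  have hE0 : E0 = 0 := by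
    have : (4 * ((n : ℂ) - 1) + 8 * M) * E0 = 0 := by
      linear_combination hsum + (2 * ((n : ℂ) - 1)) * h3 - 4 * h2 + 4 * e3 - 4 * h1 + 4 * M * h3
    refine (mul_eq_zero.1 this).resolve_left ?_
    have h6 : (4 * ((n : ℝ) - 1) + 8 * M) ≠ 0 := by
      have : (3 : ℝ) ≤ n := by exact_mod_cast hn
      have : (0 : ℝ) ≤ M := by positivity
      nlinarith
    exact_mod_cast h6
  refine ⟨hE0, fun k => ?_⟩
  have h7 := h4 _ (hV k)
  have h8 : ∑ p, (V k p : ℂ) * E p = E k - ω k * e := by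
    have hh : ∀ p, (V k p : ℂ) * E p = (if p = k then E p else 0) - ω k * (ω p * E p) := by
      intro p
      simp only [V]
      push_cast
      split_ifs <;> simp <;> ring
    simp only [hh, Finset.sum_sub_distrib, he, Finset.mul_sum]
    simp
  have h9 : e = 0 := by rw [hE0] at h3; simpa using h3
  rw [h8, h9] at h7
  simpa using h7

lemma cv_deriv (n : ℕ) (ω v : Fin n → ℝ) (u : ℝ) (a : Fin (n + 1)) :
    HasDerivAt (fun u => cv n ω v u a)
      ((Fin.cons (2 * (∑ p, v p ^ 2) * u)
        (fun p => -2 * (∑ p, v p ^ 2) * u * ω p + 2 * v p) : Fin (n + 1) → ℝ) a) u := by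
  refine Fin.cases ?_ (fun p => ?_) a
  · simp only [cv, Fin.cons_zero]
    have := (((hasDerivAt_id u).pow 2).const_mul (∑ p, v p ^ 2)).const_add 1
    exact this.congr_deriv (by simp only [id, Nat.cast_ofNat, Nat.add_one_sub_one, pow_one]; ring)
  · simp only [cv, Fin.cons_succ]
    have := ((((((hasDerivAt_id u).pow 2).const_mul (∑ p, v p ^ 2)).const_sub 1)).mul_const
      (ω p)).add ((((hasDerivAt_id u).const_mul 2)).mul_const (v p))
    exact this.congr_deriv (by simp only [id, Nat.cast_ofNat, Nat.add_one_sub_one, pow_one]; ring)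

lemma tf_step (n M : ℕ) (hn : 3 ≤ n) (ω₀ : Fin n → ℝ) (δ : ℝ)
    (T : (Fin (M + 1) → Fin (n + 1)) → ℂ) (hs : Sy T) (ht : TF T)
    (h : ∀ ω, inBall n ω₀ δ ω → ev (n + 1) (M + 1) T (ld n 1 ω) = 0)
    (ω : Fin n → ℝ) (hω : inBall n ω₀ δ ω) (a : Fin (n + 1)) :
    ev (n + 1) M (ct T a) (ld n 1 ω) = 0 := by
  have hcv : ∀ v : Fin n → ℝ, ∑ p, ω p * v p = 0 →
      ∀ᶠ u in nhds (0 : ℝ), ev (n + 1) (M + 1) T (cv n ω v u) = 0 := by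
    intro v hv
    filter_upwards [cv_ball n ω₀ ω v δ hω hv] with u hu
    rw [cv_eq, ev_smul, h _ hu, mul_zero]
  -- first derivative
  have hd1 : ∀ v : Fin n → ℝ, ∑ p, ω p * v p = 0 → ∀ᶠ u in nhds (0 : ℝ),
      ∑ b, ((Fin.cons (2 * (∑ p, v p ^ 2) * u)
        (fun p => -2 * (∑ p, v p ^ 2) * u * ω p + 2 * v p) : Fin (n + 1) → ℝ) b : ℂ) *
        ev (n + 1) M (ct T b) (cv n ω v u) = 0 := by
    intro v hv
    filter_upwards [(hcv v hv).eventually_nhds] with u hu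
    have h1 := ev_hasDerivAt hs (cv n ω v) _ u (cv_deriv n ω v u)
    have h2 := h1.unique ((hasDerivAt_const u (0 : ℂ)).congr_of_eventuallyEq hu)
    simp only [dv] at h2
    have h3 : ((M : ℂ) + 1) ≠ 0 := by exact_mod_cast Nat.succ_ne_zero M
    refine (mul_eq_zero.1 ?_).resolve_left h3
    rw [← h2, Finset.mul_sum]
    exact Finset.sum_congr rfl fun b _ => by ring
  have key := alg_zero n M hn ω hω.1 (ev (n + 1) M (ct T 0) (ld n 1 ω))
    (fun p => ev (n + 1) M (ct T p.succ) (ld n 1 ω))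
    (dv (n + 1) M (ct T 0) 0 (ld n 1 ω))
    (fun p => dv (n + 1) M (ct T 0) p.succ (ld n 1 ω))
    (fun p q => dv (n + 1) M (ct T p.succ) q.succ (ld n 1 ω))
    ?_ ?_ ?_ ?_ ?_ ?_
  · refine Fin.cases key.1 (fun p => key.2 p) a
  · rw [← dv_euler, Fin.sum_univ_succ]; simp [ld]
  · intro p
    rw [← dv_euler, Fin.sum_univ_succ, hs.dv_comm]; simp [ld]
  · exact dv_trace ht _
  · have := h ω hω
    rw [ev_succ, Fin.sum_univ_succ] at this
    simpa [ld] using this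
  · intro v hv
    have := (hd1 v hv).self_of_nhds
    rw [cv_zero, Fin.sum_univ_succ] at this
    simp only [Fin.cons_zero, Fin.cons_succ] at this
    have h2 : (2 : ℂ) * ∑ p, (v p : ℂ) * ev (n + 1) M (ct T p.succ) (ld n 1 ω) = 0 := by
      rw [← this, Finset.mul_sum]
      simp [mul_assoc]
    exact (mul_eq_zero.1 h2).resolve_left two_ne_zero
  · intro v hv
    set c := ∑ p, v p ^ 2 with hc
    have hg : ∀ b, HasDerivAt (fun u : ℝ => ((Fin.cons (2 * c * u)
        (fun p => -2 * c * u * ω p + 2 * v p) : Fin (n + 1) → ℝ) b))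
        ((Fin.cons (2 * c) (fun p => -2 * c * ω p) : Fin (n + 1) → ℝ) b) 0 := by
      intro b
      refine Fin.cases ?_ (fun p => ?_) b
      · simp only [Fin.cons_zero]
        simpa using (hasDerivAt_id (0:ℝ)).const_mul (2 * c)
      · simp only [Fin.cons_succ]
        simpa using ((((hasDerivAt_id (0:ℝ)).const_mul (-2 * c)).mul_const (ω p)).add_const
          (2 * v p))
    have h1 := HasDerivAt.fun_sum (u := Finset.univ) (fun b _ => ((hg b).ofReal_comp).mul
      (ev_hasDerivAt (hs.ct b) (cv n ω v) _ 0 (cv_deriv n ω v 0)))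
    have h2 := h1.unique ((hasDerivAt_const (0 : ℝ) (0 : ℂ)).congr_of_eventuallyEq (hd1 v hv))
    rw [cv_zero, Fin.sum_univ_succ] at h2
    simp only [Fin.sum_univ_succ, Fin.cons_zero, Fin.cons_succ] at h2
    simp only [mul_zero, Complex.ofReal_zero, zero_mul, zero_add, add_zero] at h2
    rw [← h2, Finset.sum_add_distrib]
    have hcc : (∑ p, (v p : ℂ) ^ 2) = c := by rw [hc]; push_cast; rfl
    clear_value c
    have ea : ∑ x, ((-2 * c * ω x : ℝ) : ℂ) * ev (n + 1) M (ct T x.succ) (ld n 1 ω)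
        = -2 * c * ∑ p, (ω p : ℂ) * ev (n + 1) M (ct T p.succ) (ld n 1 ω) := by
      rw [Finset.mul_sum]
      refine Finset.sum_congr rfl fun p _ => ?_
      push_cast; ring
    have eb : ∑ x, ((2 * v x : ℝ) : ℂ) * ∑ y, ((2 * v y : ℝ) : ℂ) *
          dv (n + 1) M (ct T x.succ) y.succ (ld n 1 ω)
        = 4 * ∑ p, ∑ q, (v p : ℂ) * v q * dv (n + 1) M (ct T p.succ) q.succ (ld n 1 ω) := by
      simp_rw [Finset.mul_sum]
      refine Finset.sum_congr rfl fun p _ => ?_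
      refine Finset.sum_congr rfl fun q _ => ?_
      push_cast; ring
    rw [hcc, ea, eb]
    push_cast; ring

lemma tf_zero (n M : ℕ) (hn : 3 ≤ n) (ω₀ : Fin n → ℝ) (hω₀ : onSphere n ω₀) (δ : ℝ) (hδ : 0 < δ)
    (T : (Fin M → Fin (n + 1)) → ℂ) (hs : Sy T) (ht : TF T)
    (h : ∀ ω, inBall n ω₀ δ ω → ev (n + 1) M T (ld n 1 ω) = 0) : ∀ i, T i = 0 := by
  induction M with
  | zero =>
    intro i
    have := h ω₀ ⟨hω₀, by simpa using pow_pos hδ 2⟩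
    simp only [ev, Finset.univ_eq_empty, Finset.prod_empty, one_mul,
      Fintype.sum_unique] at this
    rw [← this]; congr 1; exact Subsingleton.elim _ _
  | succ M ih =>
    intro i
    have := ih (ct T (i 0)) (hs.ct _) (ht.ct hs _)
      (fun ω hω => tf_step n M hn ω₀ δ T hs ht h ω hω (i 0)) (Fin.tail i)
    simpa [ct] using this

/-! ### Part 2: moments -/

lemma exists_chi : ∃ χ : ℝ → ℂ, Continuous χ ∧ HasCompactSupport χ ∧ ∫ s, χ s = 1 := by
  let b : ContDiffBump (0 : ℝ) := ⟨1, 2, one_pos, one_lt_two⟩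
  refine ⟨fun s => (b.normed volume s : ℂ), ?_, ?_, ?_⟩
  · exact Complex.continuous_ofReal.comp b.continuous_normed
  · exact b.hasCompactSupport_normed.comp_left (g := fun r : ℝ => (r : ℂ)) (by simp)
  · rw [integral_complex_ofReal, b.integral_normed]; simp

lemma fub {N : ℕ} (M : ℕ) (F : (Fin N → ℝ) → ℂ) (hF : Continuous F) (hFc : HasCompactSupport F)
    (η : Fin N → ℝ) (b : (Fin N → ℝ) →L[ℝ] ℝ) (hb : b η = 1)
    (hm : ∀ k ≤ M, ∀ x, ∫ s : ℝ, (s : ℂ) ^ k * F (x + s • η) = 0)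
    (W : (Fin N → ℝ) → ℂ) (hW : Continuous W) (hWi : ∀ x (s : ℝ), W (x + s • η) = W x)
    (j : ℕ) (hj : j ≤ M) :
    ∫ x, F x * ((b x : ℂ) ^ j * W x) = 0 := by
  obtain ⟨χ, hχ, hχc, hχ1⟩ := exists_chi
  have s1 : ∫ x, F x * ((b x : ℂ) ^ j * W x)
      = ∫ x, ∫ s : ℝ, χ (b x - s) * (F x * ((b x : ℂ) ^ j * W x)) := by
    congr 1; funext x
    rw [integral_mul_const, integral_sub_left_eq_self, hχ1, one_mul]
  have s2 : ∫ x, ∫ s : ℝ, χ (b x - s) * (F x * ((b x : ℂ) ^ j * W x))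
      = ∫ s : ℝ, ∫ x, χ (b x - s) * (F x * ((b x : ℂ) ^ j * W x)) := by
    apply integral_integral_swap_of_hasCompactSupport
    · simp only [Function.uncurry_def]; fun_prop
    · refine HasCompactSupport.intro
        ((hFc.isCompact.prod hχc.isCompact).image
          (f := fun q : (Fin N → ℝ) × ℝ => (q.1, b q.1 - q.2)) (by fun_prop)) ?_
      rintro ⟨x, s⟩ hx
      simp only [Function.uncurry_def]
      by_contra hne
      apply hx
      refine ⟨(x, b x - s), ⟨subset_tsupport _ ?_, subset_tsupport _ ?_⟩, by simp⟩
      · intro h0; apply hne; simp [h0]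
      · intro h0; apply hne; simp only at h0; simp [h0]
  have s3 : ∀ s : ℝ, ∫ x, χ (b x - s) * (F x * ((b x : ℂ) ^ j * W x))
      = ∫ x, χ (b x) * (F (x + s • η) * (((b x : ℂ) + s) ^ j * W x)) := by
    intro s
    rw [← integral_add_right_eq_self _ (s • η)]
    congr 1; funext x
    simp [hWi, hb]
  have s4 : ∫ s : ℝ, ∫ x, χ (b x) * (F (x + s • η) * (((b x : ℂ) + s) ^ j * W x))
      = ∫ x, ∫ s : ℝ, χ (b x) * (F (x + s • η) * (((b x : ℂ) + s) ^ j * W x)) := by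
    apply integral_integral_swap_of_hasCompactSupport
    · simp only [Function.uncurry_def]; fun_prop
    · refine HasCompactSupport.intro
        ((hFc.isCompact.prod hχc.isCompact).image
          (f := fun q : (Fin N → ℝ) × ℝ => (b q.1 - q.2, q.1 - (b q.1 - q.2) • η))
            (by fun_prop)) ?_
      rintro ⟨s, x⟩ hx
      simp only [Function.uncurry_def]
      by_contra hne
      apply hx
      refine ⟨(x + s • η, b x), ⟨subset_tsupport _ ?_, subset_tsupport _ ?_⟩, by simp [hb]⟩
      · intro h0; apply hne; simp only at h0; simp [h0]
      · intro h0; apply hne; simp only at h0; simp [h0]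
  rw [s1, s2]
  simp_rw [s3]
  rw [s4]
  refine integral_eq_zero_of_ae (Filter.Eventually.of_forall fun x => ?_)
  simp only [Pi.zero_apply]
  have hcs : HasCompactSupport fun s : ℝ => F (x + s • η) := by
    refine HasCompactSupport.intro
      (hFc.isCompact.image (f := fun y => b y - b x) (by fun_prop)) ?_
    intro s hs
    by_contra hne
    exact hs ⟨x + s • η, subset_tsupport _ hne, by simp [hb]⟩
  have hIntg : ∀ r : ℕ, Integrable fun s : ℝ => (s : ℂ) ^ r * F (x + s • η) := fun r =>
    Continuous.integrable_of_hasCompactSupport (by fun_prop) hcs.mul_left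
  have e1 : ∀ s : ℝ, χ (b x) * (F (x + s • η) * (((b x : ℂ) + s) ^ j * W x))
      = ∑ r ∈ Finset.range (j + 1), (χ (b x) * W x * (b x : ℂ) ^ r * (j.choose r : ℂ)) *
          ((s : ℂ) ^ (j - r) * F (x + s • η)) := by
    intro s
    rw [add_pow, Finset.sum_mul, Finset.mul_sum, Finset.mul_sum]
    exact Finset.sum_congr rfl fun r _ => by ring
  simp_rw [e1]
  rw [integral_finsetSum _ (fun r _ => (hIntg _).const_mul _)]
  refine Finset.sum_eq_zero fun r _ => ?_
  rw [integral_const_mul, hm _ (by omega), mul_zero]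

section
variable {n M : ℕ}

lemma ev_cont {f : (Fin M → Fin (n + 1)) → (Fin (n + 1) → ℝ) → ℂ} (hf : IsCc n M f)
    (η : Fin (n + 1) → ℝ) : Continuous fun x => ev (n + 1) M (fun i => f i x) η := by
  unfold ev
  exact continuous_finsetSum _ fun i _ => continuous_const.mul (hf i).1.continuous

lemma ev_cs {f : (Fin M → Fin (n + 1)) → (Fin (n + 1) → ℝ) → ℂ} (hf : IsCc n M f)
    (η : Fin (n + 1) → ℝ) : HasCompactSupport fun x => ev (n + 1) M (fun i => f i x) η := by
  refine HasCompactSupport.intro (K := ⋃ i, tsupport (f i))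
    (isCompact_iUnion fun i => (hf i).2) ?_
  intro x hx
  unfold ev
  refine Finset.sum_eq_zero fun i _ => ?_
  have : x ∉ tsupport (f i) := fun h => hx (Set.mem_iUnion.2 ⟨i, h⟩)
  simp only [image_eq_zero_of_notMem_tsupport this, mul_zero]

lemma line_cs {N : ℕ} {F : (Fin N → ℝ) → ℂ} (hFc : HasCompactSupport F)
    (x η : Fin N → ℝ) (a : Fin N) (ha : η a ≠ 0) :
    HasCompactSupport fun s : ℝ => F (x + s • η) := by
  refine HasCompactSupport.intro
    (hFc.isCompact.image (f := fun y => (y a - x a) / η a) (by fun_prop)) ?_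
  intro s hs
  by_contra hne
  exact hs ⟨x + s • η, subset_tsupport _ hne, by simp [ha]⟩

lemma mlrt_eq {f : (Fin M → Fin (n + 1)) → (Fin (n + 1) → ℝ) → ℂ} (hf : IsCc n M f)
    (k : ℕ) (x : Fin (n + 1) → ℝ) (ω : Fin n → ℝ) :
    mlrt n M 1 k f x ω
      = ∫ s : ℝ, (s : ℂ) ^ k * ev (n + 1) M (fun i => f i (x + s • ld n 1 ω)) (ld n 1 ω) := by
  unfold mlrt ev
  simp_rw [Finset.mul_sum]
  rw [integral_finsetSum]
  · refine Finset.sum_congr rfl fun i _ => ?_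
    rw [← integral_const_mul]
    congr 1; funext s; ring
  · intro i _
    refine Continuous.integrable_of_hasCompactSupport ?_ ?_
    · have := (hf i).1.continuous
      fun_prop
    · exact (((line_cs (hf i).2 x (ld n 1 ω) 0 (by simp [ld])).mul_left).mul_left)

lemma moment_cv {f : (Fin M → Fin (n + 1)) → (Fin (n + 1) → ℝ) → ℂ} (hf : IsCc n M f)
    (k : ℕ) (ω : Fin n → ℝ) (h : ∀ x, mlrt n M 1 k f x ω = 0) (w : ℝ) (hw : 0 < w)
    (x : Fin (n + 1) → ℝ) :
    ∫ s : ℝ, (s : ℂ) ^ k * ev (n + 1) M (fun i => f i (x + s • (w • ld n 1 ω)))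
      (w • ld n 1 ω) = 0 := by
  have h0 := h x
  rw [mlrt_eq hf] at h0
  have h1 := Measure.integral_comp_mul_left (fun s : ℝ => (s : ℂ) ^ k *
    ev (n + 1) M (fun i => f i (x + s • ld n 1 ω)) (ld n 1 ω)) w
  rw [h0, smul_zero] at h1
  have hw' : (w : ℂ) ≠ 0 := by exact_mod_cast hw.ne'
  have h2 : ∀ s : ℝ, (s : ℂ) ^ k * ev (n + 1) M (fun i => f i (x + s • (w • ld n 1 ω)))
      (w • ld n 1 ω) = ((w : ℂ) ^ M * ((w : ℂ) ^ k)⁻¹) * (((w * s : ℝ) : ℂ) ^ k *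
        ev (n + 1) M (fun i => f i (x + (w * s) • ld n 1 ω)) (ld n 1 ω)) := by
    intro s
    rw [ev_smul, smul_smul, mul_comm s w]
    push_cast
    rw [mul_pow]
    field_simp
  simp_rw [h2]
  rw [integral_const_mul, h1, mul_zero]

open Polynomial in
/-- Coordinates of the conic as polynomials. -/
def cvP (n : ℕ) (ω v : Fin n → ℝ) : Fin (n + 1) → ℂ[X] :=
  Fin.cons (C ((∑ p, v p ^ 2 : ℝ) : ℂ) * X ^ 2 + C 0 * X + C 1)
    (fun p => C ((-(∑ p, v p ^ 2) * ω p : ℝ) : ℂ) * X ^ 2 + C ((2 * v p : ℝ) : ℂ) * X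
      + C (ω p : ℂ))

open Polynomial in
lemma cvP_eval (ω v : Fin n → ℝ) (u : ℝ) (a : Fin (n + 1)) :
    (cvP n ω v a).eval (u : ℂ) = (cv n ω v u a : ℂ) := by
  refine Fin.cases ?_ (fun p => ?_) a
  · simp [cvP, cv, eval_finsetSum]; ring
  · simp [cvP, cv, eval_finsetSum]; ring

open Polynomial in
lemma cvP_deg (ω v : Fin n → ℝ) (a : Fin (n + 1)) : (cvP n ω v a).natDegree ≤ 2 := by
  refine Fin.cases ?_ (fun p => ?_) a
  · exact natDegree_quadratic_le
  · exact natDegree_quadratic_le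

open Polynomial in
/-- The polynomial `u ↦ Σ γ(u)^i A_i`. -/
lemma evP (ω v : Fin n → ℝ) (A : (Fin M → Fin (n + 1)) → ℂ) :
    ∃ p : ℂ[X], p.natDegree ≤ 2 * M ∧ ∀ u : ℝ, p.eval (u : ℂ) = ev (n + 1) M A (cv n ω v u) := by
  refine ⟨∑ i : Fin M → Fin (n + 1), (∏ j, cvP n ω v (i j)) * C (A i), ?_, fun u => ?_⟩
  · refine natDegree_sum_le_of_forall_le _ _ fun i _ => ?_
    refine (natDegree_mul_C_le _ _).trans ((natDegree_prod_le _ _).trans ?_)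
    refine (Finset.sum_le_sum fun j _ => cvP_deg ω v (i j)).trans ?_
    simp [mul_comm]
  · simp [ev, eval_finsetSum, eval_prod, cvP_eval]

lemma int_ev {f : (Fin M → Fin (n + 1)) → (Fin (n + 1) → ℝ) → ℂ} (hf : IsCc n M f)
    (η : Fin (n + 1) → ℝ) (G : (Fin (n + 1) → ℝ) → ℂ) (hG : Continuous G) :
    Integrable fun x => ev (n + 1) M (fun i => f i x) η * G x :=
  Continuous.integrable_of_hasCompactSupport ((ev_cont hf η).mul hG) ((ev_cs hf η).mul_right)

lemma ev_int {f : (Fin M → Fin (n + 1)) → (Fin (n + 1) → ℝ) → ℂ} (hf : IsCc n M f)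
    (η : Fin (n + 1) → ℝ) (G : (Fin (n + 1) → ℝ) → ℂ) (hG : Continuous G) :
    ∫ x, ev (n + 1) M (fun i => f i x) η * G x
      = ev (n + 1) M (fun i => ∫ x, f i x * G x) η := by
  unfold ev
  simp_rw [Finset.sum_mul]
  rw [integral_finsetSum]
  · refine Finset.sum_congr rfl fun i _ => ?_
    rw [← integral_const_mul]
    congr 1; funext s; ring
  · intro i _
    refine Continuous.integrable_of_hasCompactSupport ?_ ?_
    · have := (hf i).1.continuous
      fun_prop
    · exact ((hf i).2.mul_left).mul_right

open Polynomial in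
lemma intP {f : (Fin M → Fin (n + 1)) → (Fin (n + 1) → ℝ) → ℂ} (hf : IsCc n M f)
    (ω v : Fin n → ℝ) (b ζ : (Fin (n + 1) → ℝ) →L[ℝ] ℝ) (Lp : ℂ[X])
    (hL : ∀ u : ℝ, Lp.eval (u : ℂ) = (ζ (cv n ω v u) : ℂ)) (a k j : ℕ) :
    ∃ p : ℂ[X], ∀ u : ℝ, p.eval (u : ℂ) = ∫ x, ev (n + 1) M (fun i => f i x) (cv n ω v u) *
      ((ζ x : ℂ) ^ k * (b x : ℂ) ^ j * ((ζ x : ℂ) - b x * ζ (cv n ω v u)) ^ a) := by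
  induction a generalizing k j with
  | zero =>
    obtain ⟨p, -, hp⟩ := evP (n := n) (M := M) ω v
      (fun i => ∫ x, f i x * ((ζ x : ℂ) ^ k * (b x : ℂ) ^ j))
    refine ⟨p, fun u => ?_⟩
    rw [hp, ← ev_int hf _ _ (by fun_prop)]
    simp
  | succ a ih =>
    obtain ⟨p, hp⟩ := ih (k + 1) j
    obtain ⟨q, hq⟩ := ih k (j + 1)
    refine ⟨p - Lp * q, fun u => ?_⟩
    rw [eval_sub, eval_mul, hp, hq, hL, ← integral_const_mul, ← integral_sub]
    · congr 1; funext x; ring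
    · exact int_ev hf _ _ (by fun_prop)
    · exact (int_ev hf _ _ (by fun_prop)).const_mul _

open Polynomial in
lemma moments_zero {f : (Fin M → Fin (n + 1)) → (Fin (n + 1) → ℝ) → ℂ} (hf : IsCc n M f)
    (ω₀ : Fin n → ℝ) (δ : ℝ)
    (h : ∀ k ≤ M, ∀ (x : Fin (n + 1) → ℝ) (ω : Fin n → ℝ), inBall n ω₀ δ ω →
      mlrt n M 1 k f x ω = 0)
    (ω : Fin n → ℝ) (hω : inBall n ω₀ δ ω) (v : Fin n → ℝ) (hv : ∑ p, ω p * v p = 0)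
    (hv0 : ∑ p, v p ^ 2 ≠ 0)
    (ζ : (Fin (n + 1) → ℝ) →L[ℝ] ℝ) (hζ : ζ (Fin.cons 1 (fun p => -ω p)) ≠ 0) (d : ℕ) :
    ∫ x, ev (n + 1) M (fun i => f i x) (ld n 1 ω) * (ζ x : ℂ) ^ d = 0 := by
  set c := ∑ p, v p ^ 2 with hc
  let b : (Fin (n + 1) → ℝ) →L[ℝ] ℝ := (2 : ℝ)⁻¹ • (ContinuousLinearMap.proj (R := ℝ) 0 +
    ∑ p : Fin n, ω p • ContinuousLinearMap.proj (R := ℝ) (φ := fun _ : Fin (n + 1) => ℝ) p.succ)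
  have hb : ∀ u, b (cv n ω v u) = 1 := by
    intro u
    have h1 : ∑ p, ω p * ((1 - c * u ^ 2) * ω p + 2 * u * v p) = 1 - c * u ^ 2 := by
      have : ∀ p, ω p * ((1 - c * u ^ 2) * ω p + 2 * u * v p)
        = (1 - c * u ^ 2) * ω p ^ 2 + 2 * u * (ω p * v p) := fun p => by ring
      simp only [this, Finset.sum_add_distrib, ← Finset.mul_sum, hv,
        show ∑ p, ω p ^ 2 = 1 from hω.1]
      ring
    simp only [b, cv, _root_.smul_apply, _root_.add_apply,
      _root_.sum_apply, ContinuousLinearMap.proj_apply, Fin.cons_zero,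
      Fin.cons_succ, smul_eq_mul]
    rw [← hc, h1]; ring
  let Lp : ℂ[X] := C ((c * ζ (Fin.cons 1 (fun p => -ω p)) : ℝ) : ℂ) * X ^ 2
    + C ((2 * ζ (Fin.cons 0 v) : ℝ) : ℂ) * X + C ((ζ (ld n 1 ω) : ℝ) : ℂ)
  have hLd : Lp.natDegree = 2 := by
    apply natDegree_quadratic
    exact_mod_cast mul_ne_zero hv0 hζ
  have hL : ∀ u : ℝ, Lp.eval (u : ℂ) = (ζ (cv n ω v u) : ℂ) := by
    intro u
    have h1 : cv n ω v u = (c * u ^ 2) • (Fin.cons 1 (fun p => -ω p) : Fin (n + 1) → ℝ)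
        + (2 * u) • (Fin.cons 0 v : Fin (n + 1) → ℝ) + ld n 1 ω := by
      funext a
      refine Fin.cases ?_ (fun p => ?_) a
      · simp [cv, ld, hc]; ring
      · simp [cv, ld, hc]; ring
    rw [h1, map_add, map_add, map_smul, map_smul]
    simp [Lp]; ring
  obtain ⟨p, hpd, hp⟩ := evP (n := n) (M := M) ω v (fun i => ∫ x, f i x * (ζ x : ℂ) ^ d)
  choose Q hQ using fun j => intP hf ω v b ζ Lp hL (d - j) 0 j
  let q : ℂ[X] := ∑ j ∈ Finset.range (d + 1),
    if j ≤ M then 0 else C (d.choose j : ℂ) * Lp ^ (j - (M + 1)) * Q j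
  have hpq : p = Lp ^ (M + 1) * q := by
    apply eq_of_infinite_eval_eq
    have hev := cv_ball n ω₀ ω v δ hω hv
    have hinf : Set.Infinite {u : ℝ | inBall n ω₀ δ (fun p => (1 + (∑ p, v p ^ 2) * u ^ 2)⁻¹ *
        ((1 - (∑ p, v p ^ 2) * u ^ 2) * ω p + 2 * u * v p))} := infinite_of_mem_nhds 0 hev
    refine Set.Infinite.mono ?_ (hinf.image (f := fun u : ℝ => (u : ℂ))
      Complex.ofReal_injective.injOn)
    rintro _ ⟨u, hu, rfl⟩
    simp only [Set.mem_ofPred_eq] at hu ⊢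
    have hmom : ∀ k ≤ M, ∀ x, ∫ s : ℝ, (s : ℂ) ^ k *
        (fun x => ev (n + 1) M (fun i => f i x) (cv n ω v u)) (x + s • cv n ω v u) = 0 := by
      intro k hk x
      simp only
      rw [cv_eq]
      exact moment_cv hf k _ (fun x => h k hk x _ hu) _ (cv_pos n v u) x
    rw [hp, ← ev_int hf _ _ (by fun_prop)]
    have e1 : ∀ x, ev (n + 1) M (fun i => f i x) (cv n ω v u) * (ζ x : ℂ) ^ d
        = ∑ j ∈ Finset.range (d + 1), ((d.choose j : ℂ) * (ζ (cv n ω v u) : ℂ) ^ j) *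
          (ev (n + 1) M (fun i => f i x) (cv n ω v u) *
            ((ζ x : ℂ) ^ 0 * (b x : ℂ) ^ j *
              ((ζ x : ℂ) - b x * ζ (cv n ω v u)) ^ (d - j))) := by
      intro x
      have : (ζ x : ℂ) = b x * ζ (cv n ω v u) + ((ζ x : ℂ) - b x * ζ (cv n ω v u)) := by ring
      conv_lhs => rw [this]
      rw [add_pow, Finset.mul_sum]
      refine Finset.sum_congr rfl fun j _ => ?_
      rw [mul_pow]; ring
    simp_rw [e1]
    rw [integral_finsetSum _ (fun j _ => (int_ev hf _ _ (by fun_prop)).const_mul _)]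
    simp only [q]
    rw [eval_mul, eval_finsetSum, Finset.mul_sum]
    refine Finset.sum_congr rfl fun j _ => ?_
    rw [integral_const_mul]
    split_ifs with hj
    · have := fub M _ (ev_cont hf (cv n ω v u)) (ev_cs hf (cv n ω v u)) (cv n ω v u) b (hb u) hmom
        (fun x => ((ζ x : ℂ) - b x * ζ (cv n ω v u)) ^ (d - j)) (by fun_prop)
        (fun x s => by simp [hb u]; ring) j hj
      simp only [pow_zero, one_mul]
      rw [this]; simp
    · rw [← hQ]
      have hjM : j = (M + 1) + (j - (M + 1)) := by omega
      simp only [eval_mul, eval_pow, eval_C, hL]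
      conv_lhs => rw [hjM, pow_add, ← hjM]
      ring
  have hp0 : p = 0 := by
    by_contra hne
    have hq0 : q ≠ 0 := fun hq => hne (by rw [hpq, hq, mul_zero])
    have hL0 : Lp ≠ 0 := fun h0 => by rw [h0] at hLd; simp at hLd
    have := natDegree_mul (pow_ne_zero (M + 1) hL0) hq0
    rw [← hpq, natDegree_pow, hLd] at this
    omega
  have := hp 0
  rw [hp0, cv_zero, ← ev_int hf _ _ (by fun_prop)] at this
  simpa using this.symm
end

/-! ### Part 3: Fourier injectivity and conclusion -/

lemma exp_zero {N : ℕ} (F : (Fin N → ℝ) → ℂ) (hF : Continuous F) (hFc : HasCompactSupport F)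
    (ζ : (Fin N → ℝ) →L[ℝ] ℝ) (h : ∀ d : ℕ, ∫ x, F x * (ζ x : ℂ) ^ d = 0) :
    ∫ x, Complex.exp ((ζ x : ℂ) * Complex.I) * F x = 0 := by
  obtain ⟨R, hR⟩ : ∃ R, ∀ x ∈ tsupport F, ‖ζ x‖ ≤ R :=
    hFc.isCompact.exists_bound_of_continuousOn ζ.continuous.continuousOn
  let R' := max R 0
  have hR' : ∀ x ∈ tsupport F, ‖ζ x‖ ≤ R' := fun x hx => (hR x hx).trans (le_max_left _ _)
  have hIntg : ∀ d : ℕ, Integrable fun x =>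
      (((ζ x : ℂ) * Complex.I) ^ d / (d.factorial : ℂ)) * F x := fun d =>
    Continuous.integrable_of_hasCompactSupport (by fun_prop) hFc.mul_left
  have hFi : Integrable fun x => ‖F x‖ :=
    (hF.integrable_of_hasCompactSupport hFc).norm
  have hs : Summable fun d : ℕ => ∫ x, ‖(((ζ x : ℂ) * Complex.I) ^ d / (d.factorial : ℂ)) * F x‖ := by
    refine Summable.of_nonneg_of_le (fun d => integral_nonneg fun x => norm_nonneg _)
      (fun d => ?_) ((Real.summable_pow_div_factorial R').mul_right (∫ x, ‖F x‖))
    rw [← integral_const_mul]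
    refine integral_mono (hIntg d).norm (hFi.const_mul _) fun x => ?_
    simp only [norm_mul, norm_div, norm_pow, Complex.norm_I, mul_one, Complex.norm_natCast,
      Complex.norm_real]
    by_cases hx : x ∈ tsupport F
    · have := hR' x hx
      gcongr
    · rw [image_eq_zero_of_notMem_tsupport hx]; simp
  have h1 := hasSum_integral_of_summable_integral_norm hIntg hs
  have h2 : ∀ d : ℕ, ∫ x, (((ζ x : ℂ) * Complex.I) ^ d / (d.factorial : ℂ)) * F x = 0 := by
    intro d
    have : ∀ x, (((ζ x : ℂ) * Complex.I) ^ d / (d.factorial : ℂ)) * F x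
      = (Complex.I ^ d / (d.factorial : ℂ)) * (F x * (ζ x : ℂ) ^ d) := fun x => by
        rw [mul_pow]; ring
    simp_rw [this]
    rw [integral_const_mul, h d, mul_zero]
  simp_rw [h2] at h1
  have h3 := h1.unique hasSum_zero
  rw [← h3]
  congr 1; funext x
  rw [tsum_mul_right, Complex.exp_eq_exp_ℂ, NormedSpace.exp_eq_tsum_div]

open FourierTransform in
lemma F_zero {N : ℕ} (F : (Fin N → ℝ) → ℂ) (hF : Continuous F) (hFc : HasCompactSupport F)
    (a : Fin N → ℝ) (ha : a ≠ 0)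
    (h : ∀ ζ : (Fin N → ℝ) →L[ℝ] ℝ, ζ a ≠ 0 → ∀ d : ℕ, ∫ x, F x * (ζ x : ℂ) ^ d = 0) :
    ∀ x, F x = 0 := by
  let G : EuclideanSpace ℝ (Fin N) → ℂ := fun y => F (WithLp.ofLp y)
  have hG : Continuous G := hF.comp (PiLp.continuous_ofLp 2 _)
  have hGi : Integrable G := by
    have := hF.integrable_of_hasCompactSupport hFc (μ := volume)
    exact (PiLp.volume_preserving_ofLp (Fin N)).integrable_comp_of_integrable this
  have h1 : ∀ w : EuclideanSpace ℝ (Fin N), inner ℝ (WithLp.toLp 2 a) w ≠ 0 → 𝓕 G w = 0 := by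
    intro w hw
    rw [Real.fourier_eq']
    let ζ : (Fin N → ℝ) →L[ℝ] ℝ := (-2 * Real.pi) • ∑ i : Fin N,
      w i • ContinuousLinearMap.proj (R := ℝ) (φ := fun _ : Fin N => ℝ) i
    have hζ : ∀ y : EuclideanSpace ℝ (Fin N), ζ (WithLp.ofLp y) = -2 * Real.pi * inner ℝ y w := by
      intro y
      simp [ζ, PiLp.inner_apply]
    have hz := exp_zero F hF hFc ζ (h ζ (by
      have := hζ (WithLp.toLp 2 a)
      simp only at this
      rw [this]
      exact mul_ne_zero (mul_ne_zero (by norm_num) Real.pi_ne_zero) hw))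
    rw [← (PiLp.volume_preserving_ofLp (Fin N)).integral_comp
      (MeasurableEquiv.toLp 2 (Fin N → ℝ)).symm.measurableEmbedding] at hz
    rw [← hz]
    congr 1; funext y
    rw [hζ, smul_eq_mul]
  have hcont : Continuous (𝓕 G) :=
    VectorFourier.fourierIntegral_continuous Real.continuous_fourierChar
      (by exact continuous_inner) hGi
  have h2 : 𝓕 G = 0 := by
    funext w
    let A : EuclideanSpace ℝ (Fin N) := WithLp.toLp 2 a
    have hA : inner ℝ A A ≠ 0 := by
      rw [Ne, inner_self_eq_zero]
      intro h0; apply ha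
      exact (WithLp.toLp_eq_zero 2).1 h0
    have h3 : (fun ε : ℝ => 𝓕 G (w + ε • A)) = fun _ => 0 := by
      refine Continuous.ext_on (dense_compl_singleton (-(inner ℝ A w) / inner ℝ A A))
        (by fun_prop) continuous_const ?_
      intro ε hε
      apply h1
      rw [inner_add_right, inner_smul_right]
      intro h0
      apply hε
      rw [Set.mem_singleton_iff, eq_div_iff hA]
      linarith
    simpa using congrFun h3 0
  have h4 := hG.fourierInv_fourier_eq hGi (by rw [h2]; exact integrable_zero _ _ _)
  intro x
  have h5 := congrFun h4 (WithLp.toLp 2 x)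
  rw [h2, Real.fourierInv_eq] at h5
  simpa [G] using h5.symm

lemma exists_perp (n : ℕ) (hn : 3 ≤ n) (ω : Fin n → ℝ) :
    ∃ v : Fin n → ℝ, ∑ p, ω p * v p = 0 ∧ ∑ p, v p ^ 2 ≠ 0 := by
  let i : Fin n := ⟨0, by omega⟩
  let j : Fin n := ⟨1, by omega⟩
  have hij : i ≠ j := by simp [i, j]
  by_cases h : ω i = 0
  · refine ⟨Pi.single i 1, by simp [Pi.single_apply, h], ?_⟩
    simp [Pi.single_apply]
  · refine ⟨Pi.single i (ω j) - Pi.single j (ω i), ?_, ?_⟩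
    · simp [Pi.single_apply, mul_sub, Finset.sum_sub_distrib]
      ring
    · have : 0 < ((Pi.single i (ω j) - Pi.single j (ω i) : Fin n → ℝ) j) ^ 2 := by
        simp [hij.symm]
        positivity
      exact (lt_of_lt_of_le this (Finset.single_le_sum (f := fun p =>
        ((Pi.single i (ω j) - Pi.single j (ω i) : Fin n → ℝ) p) ^ 2)
        (fun p _ => sq_nonneg _) (Finset.mem_univ j))).ne'

lemma sy_snoc {n m : ℕ} {T : (Fin (m + 2) → Fin (n + 1)) → ℂ} (hs : Sy T)
    (i : Fin m → Fin (n + 1)) (p : Fin (n + 1)) :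
    T (Fin.snoc (Fin.snoc i p) p) = ct (ct T p) p i := by
  have h1 : (Fin.snoc (Fin.snoc i p : Fin (m + 1) → Fin (n + 1)) p : Fin (m + 2) → Fin (n + 1))
      = (Fin.cons p (Fin.snoc i p : Fin (m + 1) → Fin (n + 1)) : Fin (m + 2) → Fin (n + 1))
        ∘ finRotate (m + 2) := Fin.snoc_eq_cons_rotate _ _
  have h2 : (Fin.snoc i p : Fin (m + 1) → Fin (n + 1))
      = (Fin.cons p i : Fin (m + 1) → Fin (n + 1)) ∘ finRotate (m + 1) :=
    Fin.snoc_eq_cons_rotate _ _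
  rw [h1, hs, h2]
  exact (hs.ct p) _ _

/-- Let `n ≥ 3`, `c = 1`, and let `f` be a smooth compactly supported
symmetric tensor field of rank `m + 2` (i.e. of rank `≥ 2`) with `j_g f = 0`. If
`L̃^{m+2,k} f` vanishes for all `k = 0,…,m+2`, all base points and all
`ω ∈ B_n(ω₀, δ)`, then `f = 0`. -/
theorem mlrt_trace_free_injectivity
    (n m : ℕ) (hn : 3 ≤ n)
    (ω₀ : Fin n → ℝ) (hω₀ : onSphere n ω₀) (δ : ℝ) (hδ : 0 < δ)
    (f : (Fin (m + 2) → Fin (n + 1)) → (Fin (n + 1) → ℝ) → ℂ)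
    (hsym : IsSymmF n (m + 2) f) (hreg : IsCc n (m + 2) f)
    (htf : ∀ i x, jgF n m f i x = 0)
    (h : ∀ k ≤ m + 2, ∀ (x : Fin (n + 1) → ℝ) (ω : Fin n → ℝ), inBall n ω₀ δ ω →
      mlrt n (m + 2) 1 k f x ω = 0) :
    ∀ i x, f i x = 0 := by
  refine fun i x => tf_zero n (m + 2) hn ω₀ hω₀ δ hδ (fun i => f i x) ?_ ?_ ?_ i
  · intro σ i
    exact congrFun (hsym σ i) x
  · intro i
    have hs : Sy (fun i => f i x) := fun σ i => congrFun (hsym σ i) x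
    have := htf i x
    unfold jgF at this
    rw [← this, sy_snoc hs i 0 |>.symm]
    congr 1
    exact Finset.sum_congr rfl fun p _ => (sy_snoc hs i p.succ).symm
  · intro ω hω
    obtain ⟨v, hv, hv0⟩ := exists_perp n hn ω
    refine F_zero (fun x => ev (n + 1) (m + 2) (fun i => f i x) (ld n 1 ω))
      (ev_cont hreg _) (ev_cs hreg _) (Fin.cons 1 (fun p => -ω p)) ?_ ?_ x
    · intro h0
      have := congrFun h0 0
      simp at this
    · intro ζ hζ d
      exact moments_zero hreg ω₀ δ h ω hω v hv hv0 ζ hζ d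
end
end

section
/- Let n ≥ 2 and c > 0, fix ω_0 ∈ S^{n−1} and δ > 0, and let f ∈ C_c^∞(ℝ^{1+n}; S^2). Assume L̃^{2,k} f((t,x), ω) = 0 for all ω ∈ B_n(ω_0, δ), all (t,x) ∈ ℝ^{1+n} and k = 0,1,2. Then for k = 0,1, all (t,x) ∈ ℝ^{1+n} and all ω ∈ B_n(ω_0, δ): Σ_{i=1}^{n} L̃^{0,k}(f_{ii})((t,x), ω) − Σ_{i,j=1}^{n} ω_i ω_j L̃^{0,k}(f_{ij})((t,x), ω) = c(1−n) · L̃^{1,k}((f)_0)((t,x), ω), where f_{ij} denotes the (scalar) component of f and (f)_0 the vector field with components f_{j0}. -/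
open MeasureTheory Finset

noncomputable section

/-- The `k`-th momentum light ray transform of a scalar function:
`L^{0,k} h((t,x), ω) = ∫_ℝ s^k h((t,x) + s(c,ω)) ds`. -/
def lrtSc (n : ℕ) (c : ℝ) (k : ℕ) (h : (Fin (n + 1) → ℝ) → ℂ)
    (x : Fin (n + 1) → ℝ) (ω : Fin n → ℝ) : ℂ :=
  ∫ s : ℝ, (s : ℂ) ^ k * h (x + s • ld n c ω)

/-- The `k`-th momentum light ray transform of a vector field. -/
def lrtVec (n : ℕ) (c : ℝ) (k : ℕ) (v : Fin (n + 1) → (Fin (n + 1) → ℝ) → ℂ)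
    (x : Fin (n + 1) → ℝ) (ω : Fin n → ℝ) : ℂ :=
  ∑ j, (ld n c ω j : ℂ) * ∫ s : ℝ, (s : ℂ) ^ k * v j (x + s • ld n c ω)

/-- The `k`-th momentum light ray transform of a symmetric 2-tensor field. -/
def lrt2 (n : ℕ) (c : ℝ) (k : ℕ) (f : Fin (n + 1) → Fin (n + 1) → (Fin (n + 1) → ℝ) → ℂ)
    (x : Fin (n + 1) → ℝ) (ω : Fin n → ℝ) : ℂ :=
  ∑ i, ∑ j, (ld n c ω i : ℂ) * (ld n c ω j : ℂ) *
    ∫ s : ℝ, (s : ℂ) ^ k * f i j (x + s • ld n c ω)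

/-! ### Analytic part -/

/-- Partial Fourier transform in space. -/
def pft (n : ℕ) (c : ℝ) (f : (Fin (n + 1) → ℝ) → ℂ) (ζ : Fin n → ℝ) (s : ℝ) : ℂ :=
  ∫ y : Fin n → ℝ, f (Fin.cons (c * s) y) * Complex.exp (-Complex.I * ((ζ ⬝ᵥ y : ℝ) : ℂ))

/-- Moments of the full Fourier-Laplace transform. -/
def fl (k : ℕ) (a : ℝ → ℂ) (z : ℂ) : ℂ :=
  ∫ s : ℝ, (s : ℂ) ^ k * a s * Complex.exp (Complex.I * s * z)

theorem cont_dot {X : Type*} [TopologicalSpace X] {n : ℕ} {p q : X → Fin n → ℝ}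
    (hp : Continuous p) (hq : Continuous q) : Continuous fun x => p x ⬝ᵥ q x := by
  unfold dotProduct
  fun_prop

theorem cont_cons {X : Type*} [TopologicalSpace X] {n : ℕ} {p : X → ℝ} {q : X → Fin n → ℝ}
    (hp : Continuous p) (hq : Continuous q) :
    Continuous fun x => (Fin.cons (p x) (q x) : Fin (n + 1) → ℝ) := by
  refine continuous_pi fun i => ?_
  refine Fin.cases ?_ (fun j => ?_) i
  · simpa using hp
  · simp only [Fin.cons_succ]; fun_prop

theorem exists_rad {n : ℕ} {f : (Fin (n + 1) → ℝ) → ℂ} (hs : HasCompactSupport f) :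
    ∃ R : ℝ, 0 ≤ R ∧ ∀ (t : ℝ) (y : Fin n → ℝ), f (Fin.cons t y) ≠ 0 → |t| ≤ R ∧ ‖y‖ ≤ R := by
  obtain ⟨R, hR⟩ := hs.isCompact.isBounded.exists_norm_le
  refine ⟨max R 0, le_max_right _ _, fun t y h => ?_⟩
  have h1 := hR _ (subset_tsupport _ h)
  constructor
  · refine le_trans ?_ (h1.trans (le_max_left _ _))
    simpa using norm_le_pi_norm (Fin.cons t y : Fin (n + 1) → ℝ) 0
  · refine (pi_norm_le_iff_of_nonneg (le_max_right _ _)).2 fun i => ?_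
    refine le_trans ?_ (h1.trans (le_max_left _ _))
    simpa using norm_le_pi_norm (Fin.cons t y : Fin (n + 1) → ℝ) i.succ

theorem pft_cont {n : ℕ} {c : ℝ} {f : (Fin (n + 1) → ℝ) → ℂ} (hf : Continuous f)
    (hs : HasCompactSupport f) :
    Continuous fun p : (Fin n → ℝ) × ℝ => pft n c f p.1 p.2 := by
  obtain ⟨R, hR0, hR⟩ := exists_rad hs
  unfold pft
  rw [← continuousOn_univ]
  refine continuousOn_integral_of_compact_support (k := Metric.closedBall 0 R)
    (isCompact_closedBall _ _) ?_ ?_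
  · refine Continuous.continuousOn ?_
    have h1 : Continuous fun q : ((Fin n → ℝ) × ℝ) × (Fin n → ℝ) => q.1.1 ⬝ᵥ q.2 :=
      cont_dot (by fun_prop) (by fun_prop)
    have h2 : Continuous fun q : ((Fin n → ℝ) × ℝ) × (Fin n → ℝ) =>
      (Fin.cons (c * q.1.2) q.2 : Fin (n + 1) → ℝ) := cont_cons (by fun_prop) (by fun_prop)
    show Continuous fun q : ((Fin n → ℝ) × ℝ) × (Fin n → ℝ) =>
      f (Fin.cons (c * q.1.2) q.2) * Complex.exp (-Complex.I * ((q.1.1 ⬝ᵥ q.2 : ℝ) : ℂ))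
    fun_prop
  · intro p y _ hy
    by_contra h
    exact hy (by simpa using (hR _ _ (left_ne_zero_of_mul h)).2)

theorem pft_supp {n : ℕ} {c : ℝ} (hc : 0 < c) {f : (Fin (n + 1) → ℝ) → ℂ}
    (hs : HasCompactSupport f) (ζ : Fin n → ℝ) : HasCompactSupport (pft n c f ζ) := by
  obtain ⟨R, hR0, hR⟩ := exists_rad hs
  refine HasCompactSupport.intro (isCompact_closedBall (0 : ℝ) (R / c)) fun s hs => ?_
  unfold pft
  rw [integral_eq_zero_of_ae]
  refine Filter.Eventually.of_forall fun y => ?_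
  by_contra h
  have h1 := (hR _ _ (left_ne_zero_of_mul h)).1
  apply hs
  rw [abs_mul, abs_of_pos hc] at h1
  rw [mem_closedBall_zero_iff, Real.norm_eq_abs, le_div_iff₀ hc]
  linarith

theorem fl_integrable {a : ℝ → ℂ} (ha : Continuous a) (hs : HasCompactSupport a) (k : ℕ) (z : ℂ) :
    Integrable fun s : ℝ => (s : ℂ) ^ k * a s * Complex.exp (Complex.I * s * z) := by
  apply Continuous.integrable_of_hasCompactSupport (by fun_prop)
  exact (hs.mul_left).mul_right

theorem fl_deriv {a : ℝ → ℂ} (ha : Continuous a) (hs : HasCompactSupport a) (k : ℕ) (z : ℂ) :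
    HasDerivAt (fl k a) (Complex.I * fl (k + 1) a z) z := by
  have key := hasDerivAt_integral_of_dominated_loc_of_deriv_le (μ := (volume : Measure ℝ))
    (F := fun (z : ℂ) (s : ℝ) => (s : ℂ) ^ k * a s * Complex.exp (Complex.I * s * z))
    (F' := fun (z : ℂ) (s : ℝ) => Complex.I *
      ((s : ℂ) ^ (k + 1) * a s * Complex.exp (Complex.I * s * z)))
    (x₀ := z) (s := Metric.ball z 1)
    (bound := fun s : ℝ => ‖(s : ℂ) ^ (k + 1) * a s‖ * Real.exp (|s| * (‖z‖ + 1)))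
    (Metric.ball_mem_nhds z one_pos) ?_ (fl_integrable ha hs k z) ?_ ?_ ?_ ?_
  · have := key.2
    rw [integral_const_mul] at this
    exact this
  · refine Filter.Eventually.of_forall fun w => (fl_integrable ha hs k w).1
  · exact ((fl_integrable ha hs (k + 1) z).const_mul _).1
  · refine Filter.Eventually.of_forall fun s w hw => ?_
    rw [norm_mul, Complex.norm_I, one_mul, norm_mul]
    refine mul_le_mul_of_nonneg_left ?_ (norm_nonneg _)
    refine (Complex.norm_exp_le_exp_norm _).trans (Real.exp_le_exp.2 ?_)
    rw [norm_mul, norm_mul, Complex.norm_I, one_mul, Complex.norm_real, Real.norm_eq_abs]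
    refine mul_le_mul_of_nonneg_left ?_ (abs_nonneg _)
    have h1 : ‖w - z‖ < 1 := by simpa [dist_eq_norm] using hw
    have h2 := norm_add_le z (w - z)
    rw [add_sub_cancel] at h2
    linarith
  · apply Continuous.integrable_of_hasCompactSupport (by fun_prop)
    exact (hs.mul_left).norm.mul_right
  · refine Filter.Eventually.of_forall fun s w _ => ?_
    have h1 : HasDerivAt (fun w : ℂ => Complex.I * s * w) (Complex.I * s) w := by
      simpa using (hasDerivAt_id w).const_mul (Complex.I * (s : ℂ))
    have h2 := (h1.cexp).const_mul ((s : ℂ) ^ k * a s)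
    refine h2.congr_deriv ?_
    ring

/-- Fourier slice identity. -/
theorem slice {n : ℕ} {c : ℝ} (hc : 0 < c) {f : (Fin (n + 1) → ℝ) → ℂ} (hf : Continuous f)
    (hs : HasCompactSupport f) (k : ℕ) (ζ ω : Fin n → ℝ) :
    ∫ y : Fin n → ℝ, Complex.exp (-Complex.I * ((ζ ⬝ᵥ y : ℝ) : ℂ)) *
      ∫ s : ℝ, (s : ℂ) ^ k * f (Fin.cons 0 y + s • ld n c ω)
    = fl k (pft n c f ζ) ((ζ ⬝ᵥ ω : ℝ) : ℂ) := by
  obtain ⟨R, hR0, hR⟩ := exists_rad hs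
  have hld : ∀ (y : Fin n → ℝ) (s : ℝ), (Fin.cons 0 y + s • ld n c ω : Fin (n + 1) → ℝ)
      = Fin.cons (c * s) (y + s • ω) := by
    intro y s
    ext i
    refine Fin.cases ?_ (fun j => ?_) i
    · simp [ld, mul_comm]
    · simp [ld]
  simp_rw [hld, ← integral_const_mul]
  rw [integral_integral_swap_of_hasCompactSupport]
  · unfold fl
    congr 1
    ext s
    rw [← integral_add_right_eq_self _ (-(s • ω))]
    unfold pft
    rw [← integral_const_mul, ← integral_mul_const]
    congr 1
    ext y
    rw [neg_add_cancel_right, dotProduct_add, dotProduct_neg, dotProduct_smul]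
    have : Complex.exp (-Complex.I * ((ζ ⬝ᵥ y + -(s • (ζ ⬝ᵥ ω)) : ℝ) : ℂ))
       = Complex.exp (-Complex.I * ((ζ ⬝ᵥ y : ℝ) : ℂ)) *
          Complex.exp (Complex.I * s * ((ζ ⬝ᵥ ω : ℝ) : ℂ)) := by
      rw [← Complex.exp_add]
      congr 1
      push_cast
      simp only [smul_eq_mul]
      push_cast
      ring
    rw [this]
    ring
  · have h1 : Continuous fun q : (Fin n → ℝ) × ℝ => ζ ⬝ᵥ q.1 :=
      cont_dot (by fun_prop) (by fun_prop)
    have h2 : Continuous fun q : (Fin n → ℝ) × ℝ =>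
      (Fin.cons (c * q.2) (q.1 + q.2 • ω) : Fin (n + 1) → ℝ) :=
        cont_cons (by fun_prop) (by fun_prop)
    show Continuous fun q : (Fin n → ℝ) × ℝ => Complex.exp (-Complex.I * ((ζ ⬝ᵥ q.1 : ℝ) : ℂ)) *
      ((q.2 : ℂ) ^ k * f (Fin.cons (c * q.2) (q.1 + q.2 • ω)))
    fun_prop
  · refine HasCompactSupport.intro ((isCompact_closedBall (0 : Fin n → ℝ)
      (R + R / c * ‖ω‖)).prod (isCompact_closedBall (0 : ℝ) (R / c))) ?_
    rintro ⟨y, s⟩ hq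
    by_contra h
    have h0 := hR _ _ (right_ne_zero_of_mul (right_ne_zero_of_mul h))
    apply hq
    have h1 := h0.1
    rw [abs_mul, abs_of_pos hc] at h1
    have h2 : |s| ≤ R / c := by
      rw [le_div_iff₀ hc]
      linarith
    refine ⟨?_, ?_⟩
    · rw [mem_closedBall_zero_iff]
      have h3 := norm_sub_le (y + s • ω) (s • ω)
      rw [add_sub_cancel_right, norm_smul, Real.norm_eq_abs] at h3
      have h4 := mul_le_mul_of_nonneg_right h2 (norm_nonneg ω)
      have h5 := h0.2
      dsimp only at h5 ⊢
      linarith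
    · rw [mem_closedBall_zero_iff]
      exact h2

open scoped FourierTransform in
theorem ft_inj {V : Type*} [NormedAddCommGroup V] [InnerProductSpace ℝ V] [MeasurableSpace V]
    [BorelSpace V] [FiniteDimensional ℝ V] {g : V → ℂ} (hg : Continuous g)
    (hs : HasCompactSupport g)
    (h : ∀ w : V, ∫ v, Complex.exp (-Complex.I * ((inner ℝ w v : ℝ) : ℂ)) * g v = 0) :
    g = 0 := by
  have h0 : 𝓕 g = 0 := by
    ext w
    rw [Real.fourier_eq']
    have := h ((2 * Real.pi) • w)
    simp only [smul_eq_mul, Pi.zero_apply]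
    rw [← this]
    congr 1
    ext v
    congr 2
    rw [inner_smul_left, real_inner_comm]
    simp
    ring
  rw [← hg.fourierInv_fourier_eq (hg.integrable_of_hasCompactSupport hs) (by rw [h0]; exact integrable_zero _ _ _), h0]
  ext w
  rw [Real.fourierInv_eq']
  simp

theorem fl_inj {a : ℝ → ℂ} (ha : Continuous a) (hs : HasCompactSupport a)
    (h : ∀ σ : ℝ, fl 0 a σ = 0) : a = 0 := by
  refine ft_inj ha hs fun w => ?_
  rw [← h (-w)]
  unfold fl
  congr 1
  ext s
  simp only [pow_zero, one_mul]
  rw [mul_comm]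
  congr 2
  simp
  ring

theorem pft_inj {n : ℕ} (hn : 2 ≤ n) {c : ℝ} (hc : 0 < c) {f : (Fin (n + 1) → ℝ) → ℂ}
    (hf : Continuous f) (hs : HasCompactSupport f)
    (h : ∀ ζ : Fin n → ℝ, ζ ≠ 0 → ∀ σ : ℝ, fl 0 (pft n c f ζ) σ = 0) : f = 0 := by
  have hcont := pft_cont (c := c) hf hs
  have h1 : ∀ ζ : Fin n → ℝ, ζ ≠ 0 → pft n c f ζ = 0 := fun ζ hζ =>
    fl_inj (hcont.comp (by fun_prop : Continuous fun s : ℝ => (ζ, s))) (pft_supp hc hs ζ) (h ζ hζ)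
  have : NeZero n := ⟨by omega⟩
  have : Nonempty (Fin n) := ⟨0⟩
  have h2 : ∀ (ζ : Fin n → ℝ) (s : ℝ), pft n c f ζ s = 0 := by
    intro ζ s
    have hd : Dense ({0}ᶜ : Set (Fin n → ℝ)) := dense_compl_singleton 0
    have := Continuous.ext_on hd
      (hcont.comp (by fun_prop : Continuous fun ζ : Fin n → ℝ => (ζ, s))) continuous_const
      (g := fun _ => (0 : ℂ)) (fun ζ hζ => by simp [h1 ζ hζ])
    exact congrFun this ζ
  obtain ⟨R, hR0, hR⟩ := exists_rad hs
  ext x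
  have hx : x = Fin.cons (c * (x 0 / c)) (Fin.tail x) := by
    rw [mul_div_cancel₀ _ hc.ne', Fin.cons_self_tail]
  set s := x 0 / c
  have h3 : (fun y : EuclideanSpace ℝ (Fin n) => f (Fin.cons (c * s) y.ofLp)) = 0 := by
    apply ft_inj
    · exact hf.comp (cont_cons continuous_const (PiLp.continuous_ofLp _ _))
    · have hK : HasCompactSupport fun y : Fin n → ℝ => f (Fin.cons (c * s) y) := by
        refine HasCompactSupport.intro (isCompact_closedBall (0 : Fin n → ℝ) R) fun y hy => ?_
        by_contra h
        exact hy (by simpa using (hR _ _ h).2)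
      exact hK.comp_homeomorph (PiLp.homeomorph 2 (fun _ : Fin n => ℝ))
    · intro w
      rw [← h2 w.ofLp s]
      unfold pft
      rw [← (PiLp.volume_preserving_ofLp (Fin n)).integral_comp (MeasurableEquiv.toLp 2 (Fin n → ℝ)).symm.measurableEmbedding]
      congr 1
      ext y
      rw [mul_comm, EuclideanSpace.inner_eq_star_dotProduct]
      simp [dotProduct_comm]
  rw [hx]
  exact congrFun h3 (WithLp.toLp 2 (Fin.tail x))

theorem pft_integrable {n : ℕ} {c : ℝ} {f : (Fin (n + 1) → ℝ) → ℂ} (hf : Continuous f)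
    (hs : HasCompactSupport f) (ζ : Fin n → ℝ) (s : ℝ) :
    Integrable fun y : Fin n → ℝ =>
      f (Fin.cons (c * s) y) * Complex.exp (-Complex.I * ((ζ ⬝ᵥ y : ℝ) : ℂ)) := by
  obtain ⟨R, hR0, hR⟩ := exists_rad hs
  apply Continuous.integrable_of_hasCompactSupport
  · have h1 : Continuous fun y : Fin n → ℝ => ζ ⬝ᵥ y := cont_dot (by fun_prop) (by fun_prop)
    have h2 : Continuous fun y : Fin n → ℝ => (Fin.cons (c * s) y : Fin (n + 1) → ℝ) :=
      cont_cons (by fun_prop) (by fun_prop)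
    fun_prop
  · refine HasCompactSupport.intro (isCompact_closedBall (0 : Fin n → ℝ) R) fun y hy => ?_
    by_contra h
    exact hy (by simpa using (hR _ _ (left_ne_zero_of_mul h)).2)

theorem slice_integrable {n : ℕ} {c : ℝ} (hc : 0 < c) {f : (Fin (n + 1) → ℝ) → ℂ}
    (hf : Continuous f) (hs : HasCompactSupport f) (k : ℕ) (ζ ω : Fin n → ℝ) :
    Integrable fun y : Fin n → ℝ => Complex.exp (-Complex.I * ((ζ ⬝ᵥ y : ℝ) : ℂ)) *
      ∫ s : ℝ, (s : ℂ) ^ k * f (Fin.cons 0 y + s • ld n c ω) := by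
  obtain ⟨R, hR0, hR⟩ := exists_rad hs
  have hld : ∀ (y : Fin n → ℝ) (s : ℝ), (Fin.cons 0 y + s • ld n c ω : Fin (n + 1) → ℝ)
      = Fin.cons (c * s) (y + s • ω) := by
    intro y s
    ext i
    refine Fin.cases ?_ (fun j => ?_) i
    · simp [ld, mul_comm]
    · simp [ld]
  simp_rw [hld]
  have hb : ∀ (y : Fin n → ℝ) (s : ℝ), f (Fin.cons (c * s) (y + s • ω)) ≠ 0 →
      |s| ≤ R / c ∧ ‖y‖ ≤ R + R / c * ‖ω‖ := by
    intro y s h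
    have h0 := hR _ _ h
    have h1 := h0.1
    rw [abs_mul, abs_of_pos hc] at h1
    have h2 : |s| ≤ R / c := by
      rw [le_div_iff₀ hc]
      linarith
    refine ⟨h2, ?_⟩
    have h3 := norm_sub_le (y + s • ω) (s • ω)
    rw [add_sub_cancel_right, norm_smul, Real.norm_eq_abs] at h3
    have h4 := mul_le_mul_of_nonneg_right h2 (norm_nonneg ω)
    have h5 := h0.2
    linarith
  have hc1 : Continuous fun y : Fin n → ℝ =>
      ∫ s : ℝ, (s : ℂ) ^ k * f (Fin.cons (c * s) (y + s • ω)) := by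
    rw [← continuousOn_univ]
    refine continuousOn_integral_of_compact_support (k := Metric.closedBall 0 (R / c))
      (isCompact_closedBall _ _) ?_ ?_
    · have h2 : Continuous fun q : (Fin n → ℝ) × ℝ =>
        (Fin.cons (c * q.2) (q.1 + q.2 • ω) : Fin (n + 1) → ℝ) :=
          cont_cons (by fun_prop) (by fun_prop)
      refine Continuous.continuousOn ?_
      show Continuous fun q : (Fin n → ℝ) × ℝ =>
        ((q.2 : ℂ) ^ k * f (Fin.cons (c * q.2) (q.1 + q.2 • ω)))
      fun_prop
    · intro p y _ hy
      by_contra h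
      exact hy (by simpa using (hb _ _ (right_ne_zero_of_mul h)).1)
  apply Continuous.integrable_of_hasCompactSupport
  · have h1 : Continuous fun y : Fin n → ℝ => ζ ⬝ᵥ y := cont_dot (by fun_prop) (by fun_prop)
    fun_prop
  · refine HasCompactSupport.intro (isCompact_closedBall (0 : Fin n → ℝ) (R + R / c * ‖ω‖))
      fun y hy => ?_
    have : ∀ s : ℝ, f (Fin.cons (c * s) (y + s • ω)) = 0 := by
      intro s
      by_contra h
      exact hy (by simpa using (hb _ _ h).2)
    simp [this]

/-! ### Algebraic part -/

/-- Bilinear form of a complex matrix. -/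
def bf {m : ℕ} (M : Fin m → Fin m → ℂ) (a b : Fin m → ℂ) : ℂ :=
  ∑ i, ∑ j, a i * b j * M i j

theorem bf_add_left {m : ℕ} (M : Fin m → Fin m → ℂ) (a a' b : Fin m → ℂ) :
    bf M (a + a') b = bf M a b + bf M a' b := by
  simp only [bf, ← Finset.sum_add_distrib, Pi.add_apply]
  refine Finset.sum_congr rfl fun i _ => Finset.sum_congr rfl fun j _ => by ring

theorem bf_add_right {m : ℕ} (M : Fin m → Fin m → ℂ) (a b b' : Fin m → ℂ) :
    bf M a (b + b') = bf M a b + bf M a b' := by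
  simp only [bf, ← Finset.sum_add_distrib, Pi.add_apply]
  refine Finset.sum_congr rfl fun i _ => Finset.sum_congr rfl fun j _ => by ring

theorem bf_smul_left {m : ℕ} (M : Fin m → Fin m → ℂ) (r : ℂ) (a b : Fin m → ℂ) :
    bf M (r • a) b = r * bf M a b := by
  simp only [bf, Finset.mul_sum, Pi.smul_apply, smul_eq_mul]
  refine Finset.sum_congr rfl fun i _ => Finset.sum_congr rfl fun j _ => by ring

theorem bf_smul_right {m : ℕ} (M : Fin m → Fin m → ℂ) (r : ℂ) (a b : Fin m → ℂ) :
    bf M a (r • b) = r * bf M a b := by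
  simp only [bf, Finset.mul_sum, Pi.smul_apply, smul_eq_mul]
  refine Finset.sum_congr rfl fun i _ => Finset.sum_congr rfl fun j _ => by ring

theorem bf_symm {m : ℕ} {M : Fin m → Fin m → ℂ} (hM : ∀ i j, M i j = M j i) (a b : Fin m → ℂ) :
    bf M a b = bf M b a := by
  simp only [bf]
  rw [Finset.sum_comm]
  refine Finset.sum_congr rfl fun i _ => Finset.sum_congr rfl fun j _ => by rw [hM]; ring

theorem bf_deriv {m : ℕ} {φ ψ : Fin m → Fin m → ℂ → ℂ}
    (hφ : ∀ i j z, HasDerivAt (φ i j) (Complex.I * ψ i j z) z)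
    {p q : ℂ → Fin m → ℂ} {p' q' : Fin m → ℂ} {w : ℂ → ℂ} {w' θ : ℂ}
    (hp : ∀ i, HasDerivAt (fun θ => p θ i) (p' i) θ)
    (hq : ∀ i, HasDerivAt (fun θ => q θ i) (q' i) θ)
    (hw : HasDerivAt w w' θ) :
    HasDerivAt (fun θ => bf (fun i j => φ i j (w θ)) (p θ) (q θ))
      (bf (fun i j => φ i j (w θ)) p' (q θ) + bf (fun i j => φ i j (w θ)) (p θ) q'
        + Complex.I * w' * bf (fun i j => ψ i j (w θ)) (p θ) (q θ)) θ := by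
  have h1 : HasDerivAt (fun θ => bf (fun i j => φ i j (w θ)) (p θ) (q θ))
      (∑ i, ∑ j, ((p' i * q θ j + p θ i * q' j) * φ i j (w θ)
        + p θ i * q θ j * (Complex.I * ψ i j (w θ) * w'))) θ := by
    unfold bf
    refine HasDerivAt.fun_sum fun i _ => HasDerivAt.fun_sum fun j _ => ?_
    exact ((hp i).mul (hq j)).mul ((hφ i j (w θ)).comp θ hw)
  convert h1 using 1
  simp only [bf, Finset.mul_sum, ← Finset.sum_add_distrib]
  refine Finset.sum_congr rfl fun i _ => Finset.sum_congr rfl fun j _ => by ring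

/-- Spatial vector. -/
def spv {n : ℕ} (a : Fin n → ℝ) : Fin (n + 1) → ℂ := Fin.cons 0 fun i => (a i : ℂ)

/-- Time vector. -/
def tmv (n : ℕ) : Fin (n + 1) → ℂ := Fin.cons 1 0

/-- Combination of the time vector and of two spatial ones. -/
def tv {n : ℕ} (e v : Fin n → ℝ) (c C S : ℂ) : Fin (n + 1) → ℂ :=
  c • tmv n + C • spv e + S • spv v

theorem ld_eq {n : ℕ} (c α β : ℝ) (e v : Fin n → ℝ) :
    (fun i => (ld n c (α • e + β • v) i : ℂ)) = tv e v c α β := by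
  ext i
  refine Fin.cases ?_ (fun j => ?_) i <;> simp [ld, tv, spv, tmv]

theorem tv_deriv {n : ℕ} {e v : Fin n → ℝ} {c : ℂ} {C S : ℂ → ℂ} {C' S' θ : ℂ}
    (hC : HasDerivAt C C' θ) (hS : HasDerivAt S S' θ) (i : Fin (n + 1)) :
    HasDerivAt (fun θ => tv e v c (C θ) (S θ) i) (tv e v 0 C' S' i) θ := by
  simp only [tv, Pi.add_apply, Pi.smul_apply, smul_eq_mul, zero_mul]
  have := ((hasDerivAt_const θ (c * tmv n i)).add (hC.mul_const (spv e i))).add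
    (hS.mul_const (spv v i))
  exact this

/-- Analytic continuation along a great circle. -/
theorem circle {n : ℕ} {c : ℝ} {φ ψ : Fin (n + 1) → Fin (n + 1) → ℂ → ℂ}
    (hφ : ∀ i j z, HasDerivAt (φ i j) (Complex.I * ψ i j z) z) (ζ ω₀ : Fin n → ℝ) (δ : ℝ)
    (h : ∀ ω, inBall n ω₀ δ ω → bf (fun i j => φ i j ((ζ ⬝ᵥ ω : ℝ) : ℂ))
      (fun i => (ld n c ω i : ℂ)) (fun i => (ld n c ω i : ℂ)) = 0)
    {e v : Fin n → ℝ} (hee : inBall n ω₀ δ e) (hvv : v ⬝ᵥ v = 1) (hev : e ⬝ᵥ v = 0) (θ : ℂ) :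
    bf (fun i j => φ i j (Complex.cos θ * ((ζ ⬝ᵥ e : ℝ) : ℂ) + Complex.sin θ * ((ζ ⬝ᵥ v : ℝ) : ℂ)))
      (tv e v c (Complex.cos θ) (Complex.sin θ)) (tv e v c (Complex.cos θ) (Complex.sin θ)) = 0 := by
  set H : ℂ → ℂ := fun θ => bf (fun i j => φ i j (Complex.cos θ * ((ζ ⬝ᵥ e : ℝ) : ℂ) +
      Complex.sin θ * ((ζ ⬝ᵥ v : ℝ) : ℂ)))
      (tv e v c (Complex.cos θ) (Complex.sin θ)) (tv e v c (Complex.cos θ) (Complex.sin θ)) with hH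
  have hd : Differentiable ℂ H := fun θ =>
    (bf_deriv hφ (tv_deriv (Complex.hasDerivAt_cos θ) (Complex.hasDerivAt_sin θ))
      (tv_deriv (Complex.hasDerivAt_cos θ) (Complex.hasDerivAt_sin θ))
      (((Complex.hasDerivAt_cos θ).mul_const _).add
        ((Complex.hasDerivAt_sin θ).mul_const _))).differentiableAt
  have han : AnalyticOnNhd ℂ H Set.univ := fun θ _ => hd.analyticAt θ
  have hee' : e ⬝ᵥ e = 1 := by
    rw [← hee.1]; simp only [dotProduct, sq]
  have hball : ∀ᶠ t : ℝ in nhds 0, inBall n ω₀ δ (Real.cos t • e + Real.sin t • v) := by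
    have h1 : ∀ t : ℝ, onSphere n (Real.cos t • e + Real.sin t • v) := by
      intro t
      have : (Real.cos t • e + Real.sin t • v) ⬝ᵥ (Real.cos t • e + Real.sin t • v) = 1 := by
        simp only [add_dotProduct, dotProduct_add, smul_dotProduct, dotProduct_smul, smul_eq_mul,
          hee', hvv, hev, dotProduct_comm v e]
        linear_combination Real.cos_sq_add_sin_sq t
      rw [onSphere, ← this]; simp only [dotProduct, sq]
    have h2 : Continuous fun t : ℝ => ∑ i, ((Real.cos t • e + Real.sin t • v) i - ω₀ i) ^ 2 := by
      simp only [Pi.add_apply, Pi.smul_apply, smul_eq_mul]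
      fun_prop
    have h3 := h2.continuousAt.eventually_lt (continuousAt_const (x := (0 : ℝ)) (y := δ ^ 2))
      (by simpa using hee.2)
    filter_upwards [h3] with t ht
    exact ⟨h1 t, ht⟩
  have hz : ∀ᶠ t : ℝ in nhds 0, H (t : ℂ) = 0 := by
    filter_upwards [hball] with t ht
    have := h _ ht
    rw [ld_eq] at this
    rw [hH, ← this]
    simp [dotProduct_add, dotProduct_smul]
  have hfr : ∃ᶠ z in nhdsWithin (0 : ℂ) {0}ᶜ, H z = 0 := by
    have ht : Filter.Tendsto (fun t : ℝ => (t : ℂ)) (nhdsWithin 0 {0}ᶜ) (nhdsWithin 0 {0}ᶜ) := by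
      refine tendsto_nhdsWithin_iff.2 ⟨?_, ?_⟩
      · have : Filter.Tendsto (fun t : ℝ => (t : ℂ)) (nhds 0) (nhds 0) := by
          simpa using Complex.continuous_ofReal.tendsto 0
        exact this.mono_left nhdsWithin_le_nhds
      · filter_upwards [self_mem_nhdsWithin] with t ht
        simpa using ht
    exact ht.frequently (hz.filter_mono nhdsWithin_le_nhds).frequently
  exact han.eqOn_zero_of_preconnected_of_frequently_eq_zero isPreconnected_univ (Set.mem_univ 0)
    hfr (Set.mem_univ θ)

theorem exists_perp_s14 {n : ℕ} (hn : 2 ≤ n) (e : Fin n → ℝ) :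
    ∃ v : Fin n → ℝ, v ⬝ᵥ v = 1 ∧ e ⬝ᵥ v = 0 := by
  have key : ∃ v : Fin n → ℝ, v ≠ 0 ∧ e ⬝ᵥ v = 0 := by
    let i : Fin n := ⟨0, by omega⟩
    let j : Fin n := ⟨1, by omega⟩
    have hij : i ≠ j := by simp [i, j]
    by_cases h : e i = 0
    · refine ⟨Pi.single i 1, by simp, by simp [h]⟩
    · refine ⟨Pi.single j (e i) - Pi.single i (e j), ?_, ?_⟩
      · intro h0
        have := congrFun h0 j
        simp [hij, hij.symm] at this
        exact h this
      · simp [dotProduct_sub, mul_comm]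
  obtain ⟨v, hv, hev⟩ := key
  have h0 : 0 < v ⬝ᵥ v := by
    have := dotProduct_self_eq_zero (v := v)
    have h1 : 0 ≤ v ⬝ᵥ v := Finset.sum_nonneg fun i _ => mul_self_nonneg _
    exact lt_of_le_of_ne h1 fun h => hv (this.1 h.symm)
  refine ⟨(√(v ⬝ᵥ v))⁻¹ • v, ?_, ?_⟩
  · rw [smul_dotProduct, dotProduct_smul, smul_eq_mul, smul_eq_mul]
    have := Real.mul_self_sqrt h0.le
    have h3 := (Real.sqrt_pos.2 h0).ne'
    field_simp
    rw [sq, this]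
  · rw [dotProduct_smul, hev, smul_zero]

theorem exists_decomp {n : ℕ} (hn : 2 ≤ n) (e : Fin n → ℝ) (he : e ⬝ᵥ e = 1) (a : Fin n → ℝ) :
    ∃ (v : Fin n → ℝ) (α β : ℝ), v ⬝ᵥ v = 1 ∧ e ⬝ᵥ v = 0 ∧ a = α • e + β • v := by
  by_cases h : a - (e ⬝ᵥ a) • e = 0
  · obtain ⟨v, hv, hev⟩ := exists_perp_s14 hn e
    exact ⟨v, e ⬝ᵥ a, 0, hv, hev, by rw [zero_smul, add_zero]; exact sub_eq_zero.1 h⟩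
  · set v := a - (e ⬝ᵥ a) • e with hv
    have hev : e ⬝ᵥ v = 0 := by
      rw [hv, dotProduct_sub, dotProduct_smul, he]; simp
    have h0 : 0 < v ⬝ᵥ v := by
      have := dotProduct_self_eq_zero (v := v)
      have h1 : 0 ≤ v ⬝ᵥ v := Finset.sum_nonneg fun i _ => mul_self_nonneg _
      exact lt_of_le_of_ne h1 fun h' => h (this.1 h'.symm)
    have h3 := (Real.sqrt_pos.2 h0).ne'
    refine ⟨(√(v ⬝ᵥ v))⁻¹ • v, e ⬝ᵥ a, √(v ⬝ᵥ v), ?_, ?_, ?_⟩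
    · rw [smul_dotProduct, dotProduct_smul, smul_eq_mul, smul_eq_mul]
      have := Real.mul_self_sqrt h0.le
      field_simp
      rw [sq, this]
    · rw [dotProduct_smul, hev, smul_zero]
    · rw [smul_smul, mul_inv_cancel₀ h3, one_smul, hv]; simp

/-- Vanishing extends from the ball to the sphere. -/
theorem to_sphere {n : ℕ} (hn : 2 ≤ n) {c : ℝ} {φ ψ : Fin (n + 1) → Fin (n + 1) → ℂ → ℂ}
    (hφ : ∀ i j z, HasDerivAt (φ i j) (Complex.I * ψ i j z) z) (ζ ω₀ : Fin n → ℝ) (δ : ℝ)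
    (hω₀ : onSphere n ω₀) (hδ : 0 < δ)
    (h : ∀ ω, inBall n ω₀ δ ω → bf (fun i j => φ i j ((ζ ⬝ᵥ ω : ℝ) : ℂ))
      (fun i => (ld n c ω i : ℂ)) (fun i => (ld n c ω i : ℂ)) = 0)
    (ω : Fin n → ℝ) (hω : onSphere n ω) :
    bf (fun i j => φ i j ((ζ ⬝ᵥ ω : ℝ) : ℂ))
      (fun i => (ld n c ω i : ℂ)) (fun i => (ld n c ω i : ℂ)) = 0 := by
  have he : ω₀ ⬝ᵥ ω₀ = 1 := by rw [← hω₀]; simp only [dotProduct, sq]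
  have hw : ω ⬝ᵥ ω = 1 := by rw [← hω]; simp only [dotProduct, sq]
  obtain ⟨v, α, β, hv, hev, rfl⟩ := exists_decomp hn ω₀ he ω
  simp only [add_dotProduct, dotProduct_add, smul_dotProduct, dotProduct_smul, smul_eq_mul,
          he, hv, hev, dotProduct_comm v ω₀] at hw
  have hb : inBall n ω₀ δ ω₀ := ⟨hω₀, by simpa using pow_pos hδ 2⟩
  have key := circle hφ ζ ω₀ δ h hb hv hev
  obtain ⟨θ, hθ⟩ := Complex.cos_surjective (α : ℂ)
  have hs : (Complex.sin θ - β) * (Complex.sin θ + β) = 0 := by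
    have h1 := Complex.cos_sq_add_sin_sq θ
    have h2 : (α : ℂ) * α + β * β = 1 := by
      have : α * α + β * β = 1 := by linarith
      exact_mod_cast this
    rw [hθ] at h1
    linear_combination h1 - h2
  have key2 : ∃ θ : ℂ, Complex.cos θ = α ∧ Complex.sin θ = β := by
    rcases mul_eq_zero.1 hs with h1 | h1
    · exact ⟨θ, hθ, sub_eq_zero.1 h1⟩
    · exact ⟨-θ, by simpa using hθ, by rw [Complex.sin_neg]; linear_combination -h1⟩
  obtain ⟨θ, hc, hs⟩ := key2
  have := key θ
  rw [hc, hs] at this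
  rw [ld_eq, ← this]
  simp [dotProduct_add, dotProduct_smul]

/-- The pointwise linear algebra. -/
theorem pointwise {p00 p0e p0v pee pev pvv c C S : ℂ} (hc : c ≠ 0) (hS : S ≠ 0)
    (h1 : C ^ 2 + S ^ 2 = 1)
    (G : ∀ S', S' = S ∨ S' = -S → c ^ 2 * p00 + 2 * c * C * p0e + 2 * c * S' * p0v + C ^ 2 * pee
      + 2 * C * S' * pev + S' ^ 2 * pvv = 0)
    (A : ∀ S', S' = S ∨ S' = -S → - c * S' * p0e + c * C * p0v - C * S' * pee
      + (C ^ 2 - S' ^ 2) * pev + C * S' * pvv = 0)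
    (T : ∀ S', S' = S ∨ S' = -S → S' ^ 2 * pee - 2 * C * S' * pev + C ^ 2 * pvv
      - (c * C * p0e + c * S' * p0v + C ^ 2 * pee + 2 * C * S' * pev + S' ^ 2 * pvv) = 0) :
    p0e = 0 ∧ p0v = 0 ∧ pev = 0 ∧ pee = pvv ∧ c ^ 2 * p00 = - pee := by
  have G1 := G S (Or.inl rfl)
  have G2 := G (-S) (Or.inr rfl)
  have A1 := A S (Or.inl rfl)
  have A2 := A (-S) (Or.inr rfl)
  have T1 := T S (Or.inl rfl)
  have T2 := T (-S) (Or.inr rfl)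
  have e1 : c * p0v + C * pev = 0 := by
    have : S * (c * p0v + C * pev) = 0 := by linear_combination (G1 - G2) / 4
    exact (mul_eq_zero.1 this).resolve_left hS
  have e2 : c * C * p0v + (C ^ 2 - S ^ 2) * pev = 0 := by linear_combination (A1 + A2) / 2
  have e3 : c * p0e + C * pee - C * pvv = 0 := by
    have : S * (c * p0e + C * pee - C * pvv) = 0 := by linear_combination (A2 - A1) / 2
    exact (mul_eq_zero.1 this).resolve_left hS
  have e4 : (S ^ 2 - C ^ 2) * (pee - pvv) - c * C * p0e = 0 := by
    linear_combination (T1 + T2) / 2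
  have hev : pev = 0 := by
    have : S ^ 2 * pev = 0 := by linear_combination C * e1 - e2
    exact (mul_eq_zero.1 this).resolve_left (pow_ne_zero 2 hS)
  have hve : pee - pvv = 0 := by
    have : S ^ 2 * (pee - pvv) = 0 := by linear_combination e4 + C * e3
    exact (mul_eq_zero.1 this).resolve_left (pow_ne_zero 2 hS)
  have h0v : p0v = 0 := by
    have : c * p0v = 0 := by linear_combination e1 - C * hev
    exact (mul_eq_zero.1 this).resolve_left hc
  have h0e : p0e = 0 := by
    have : c * p0e = 0 := by linear_combination e3 - C * hve
    exact (mul_eq_zero.1 this).resolve_left hc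
  refine ⟨h0e, h0v, hev, sub_eq_zero.1 hve, ?_⟩
  rw [h0e, h0v, hev] at G1
  linear_combination G1 + S ^ 2 * hve - pee * h1

/-- Structure of the transform on a great circle. -/
theorem circle_struct {n : ℕ} {c : ℝ} (hc : 0 < c)
    {φ : ℕ → Fin (n + 1) → Fin (n + 1) → ℂ → ℂ}
    (hφ : ∀ k i j z, HasDerivAt (φ k i j) (Complex.I * φ (k + 1) i j z) z)
    (hsym : ∀ k i j, φ k i j = φ k j i) (ζ : Fin n → ℝ)
    (h : ∀ k ≤ 2, ∀ ω, onSphere n ω → bf (fun i j => φ k i j ((ζ ⬝ᵥ ω : ℝ) : ℂ))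
      (fun i => (ld n c ω i : ℂ)) (fun i => (ld n c ω i : ℂ)) = 0)
    {e v : Fin n → ℝ} (hee : e ⬝ᵥ e = 1) (hvv : v ⬝ᵥ v = 1) (hev : e ⬝ᵥ v = 0)
    (hζ : ζ ⬝ᵥ v = 0) (θ : ℂ) (hS : Complex.sin θ ≠ 0) :
    let M : Fin (n + 1) → Fin (n + 1) → ℂ :=
      fun i j => φ 0 i j (Complex.cos θ * ((ζ ⬝ᵥ e : ℝ) : ℂ))
    bf M (tmv n) (spv e) = 0 ∧ bf M (tmv n) (spv v) = 0 ∧ bf M (spv e) (spv v) = 0 ∧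
      bf M (spv e) (spv e) = bf M (spv v) (spv v) ∧
      (c : ℂ) ^ 2 * bf M (tmv n) (tmv n) = - bf M (spv e) (spv e) := by
  intro M
  set r : ℂ := ((ζ ⬝ᵥ e : ℝ) : ℂ) with hr
  have hes : onSphere n e := by rw [onSphere, ← hee]; simp only [dotProduct, sq]
  have hb : inBall n e 1 e := ⟨hes, by simp⟩
  have G : ∀ k ≤ 2, ∀ θ : ℂ, bf (fun i j => φ k i j (Complex.cos θ * r))
      (tv e v c (Complex.cos θ) (Complex.sin θ)) (tv e v c (Complex.cos θ) (Complex.sin θ)) = 0 := by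
    intro k hk θ
    have := circle (hφ k) ζ e 1 (fun ω hω => h k hk ω hω.1) hb hvv hev θ
    rw [hζ] at this
    simpa using this
  have dw : ∀ θ : ℂ, HasDerivAt (fun θ => Complex.cos θ * r) (-Complex.sin θ * r) θ := fun θ =>
    (Complex.hasDerivAt_cos θ).mul_const _
  have dp : ∀ θ : ℂ, ∀ i, HasDerivAt (fun θ => tv e v c (Complex.cos θ) (Complex.sin θ) i)
      (tv e v 0 (-Complex.sin θ) (Complex.cos θ) i) θ := fun θ =>
    tv_deriv (Complex.hasDerivAt_cos θ) (Complex.hasDerivAt_sin θ)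
  have dq : ∀ θ : ℂ, ∀ i, HasDerivAt (fun θ => tv e v 0 (-Complex.sin θ) (Complex.cos θ) i)
      (tv e v 0 (-Complex.cos θ) (-Complex.sin θ) i) θ := fun θ =>
    tv_deriv (Complex.hasDerivAt_sin θ).neg (Complex.hasDerivAt_cos θ)
  have A : ∀ k ≤ 1, ∀ θ : ℂ, bf (fun i j => φ k i j (Complex.cos θ * r))
      (tv e v 0 (-Complex.sin θ) (Complex.cos θ)) (tv e v c (Complex.cos θ) (Complex.sin θ))
      = 0 := by
    intro k hk θ
    have h1 := bf_deriv (hφ k) (dp θ) (dp θ) (dw θ)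
    rw [funext (G k (by omega))] at h1
    have h2 := h1.unique (hasDerivAt_const θ (0 : ℂ))
    rw [G (k + 1) (by omega), bf_symm (fun i j => by rw [hsym])
      (tv e v c (Complex.cos θ) (Complex.sin θ))] at h2
    linear_combination h2 / 2
  have T : ∀ θ : ℂ, bf (fun i j => φ 0 i j (Complex.cos θ * r))
      (tv e v 0 (-Complex.cos θ) (-Complex.sin θ)) (tv e v c (Complex.cos θ) (Complex.sin θ)) +
      bf (fun i j => φ 0 i j (Complex.cos θ * r))
      (tv e v 0 (-Complex.sin θ) (Complex.cos θ)) (tv e v 0 (-Complex.sin θ) (Complex.cos θ))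
      = 0 := by
    intro θ
    have h1 := bf_deriv (hφ 0) (dq θ) (dp θ) (dw θ)
    rw [funext (A 0 (by omega))] at h1
    have h2 := h1.unique (hasDerivAt_const θ (0 : ℂ))
    rw [A (0 + 1) (by omega)] at h2
    linear_combination h2
  have hMs : ∀ i j, M i j = M j i := fun i j => by simp only [M]; rw [hsym]
  have s1 := bf_symm hMs (spv e) (tmv n)
  have s2 := bf_symm hMs (spv v) (tmv n)
  have s3 := bf_symm hMs (spv v) (spv e)
  have hG : ∀ S', S' = Complex.sin θ ∨ S' = - Complex.sin θ →
      bf M (tv e v c (Complex.cos θ) S') (tv e v c (Complex.cos θ) S') = 0 := by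
    rintro S' (rfl | rfl)
    · exact G 0 (by omega) θ
    · simpa using G 0 (by omega) (-θ)
  have hA : ∀ S', S' = Complex.sin θ ∨ S' = - Complex.sin θ →
      bf M (tv e v 0 (-S') (Complex.cos θ)) (tv e v c (Complex.cos θ) S') = 0 := by
    rintro S' (rfl | rfl)
    · exact A 0 (by omega) θ
    · simpa using A 0 (by omega) (-θ)
  have hT : ∀ S', S' = Complex.sin θ ∨ S' = - Complex.sin θ →
      bf M (tv e v 0 (-Complex.cos θ) (-S')) (tv e v c (Complex.cos θ) S') +
      bf M (tv e v 0 (-S') (Complex.cos θ)) (tv e v 0 (-S') (Complex.cos θ)) = 0 := by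
    rintro S' (rfl | rfl)
    · exact T θ
    · simpa using T (-θ)
  simp only [tv, bf_add_left, bf_add_right, bf_smul_left, bf_smul_right, s1, s2, s3] at hG hA hT
  refine pointwise (C := Complex.cos θ) (S := Complex.sin θ) (by exact_mod_cast hc.ne') hS
    (Complex.cos_sq_add_sin_sq θ) ?_ ?_ ?_
  · intro S' hS'
    linear_combination hG S' hS'
  · intro S' hS'
    linear_combination hA S' hS'
  · intro S' hS'
    linear_combination hT S' hS'

theorem bf_single {m : ℕ} (M : Fin m → Fin m → ℂ) (i j : Fin m) :
    bf M (Pi.single i 1) (Pi.single j 1) = M i j := by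
  unfold bf
  rw [Finset.sum_eq_single i, Finset.sum_eq_single j]
  · simp
  · intro b _ hb; simp [hb]
  · simp
  · intro b _ hb; simp [hb]
  · simp

theorem spv_single {n : ℕ} (i : Fin n) : spv (Pi.single i 1) = Pi.single i.succ 1 := by
  ext j
  refine Fin.cases ?_ (fun j => ?_) j
  · simp [spv, (Fin.succ_ne_zero i).symm]
  · simp [spv, Pi.single_apply, apply_ite Complex.ofReal]

theorem tmv_single (n : ℕ) : tmv n = Pi.single 0 1 := by
  ext j
  refine Fin.cases ?_ (fun j => ?_) j
  · simp [tmv]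
  · simp [tmv]

theorem spv_comb {n : ℕ} (α β : ℝ) (e v : Fin n → ℝ) :
    spv (α • e + β • v) = (α : ℂ) • spv e + (β : ℂ) • spv v := by
  ext j
  refine Fin.cases ?_ (fun j => ?_) j <;> simp [spv]

/-- The transform is a multiple of the Minkowski metric. -/
theorem core {n : ℕ} (hn : 2 ≤ n) {c : ℝ} (hc : 0 < c)
    {φ : ℕ → Fin (n + 1) → Fin (n + 1) → ℂ → ℂ}
    (hφ : ∀ k i j z, HasDerivAt (φ k i j) (Complex.I * φ (k + 1) i j z) z)
    (hsym : ∀ k i j, φ k i j = φ k j i) (ζ : Fin n → ℝ) (hζ : ζ ≠ 0)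
    (h : ∀ k ≤ 2, ∀ ω, onSphere n ω → bf (fun i j => φ k i j ((ζ ⬝ᵥ ω : ℝ) : ℂ))
      (fun i => (ld n c ω i : ℂ)) (fun i => (ld n c ω i : ℂ)) = 0) (z : ℂ) :
    (∀ i : Fin n, φ 0 0 i.succ z = 0) ∧
    (∀ i j : Fin n, i ≠ j → φ 0 i.succ j.succ z = 0) ∧
    (∀ i : Fin n, (c : ℂ) ^ 2 * φ 0 0 0 z + φ 0 i.succ i.succ z = 0) := by
  have h0 : 0 < ζ ⬝ᵥ ζ := by
    have := dotProduct_self_eq_zero (v := ζ)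
    have h1 : 0 ≤ ζ ⬝ᵥ ζ := Finset.sum_nonneg fun i _ => mul_self_nonneg _
    exact lt_of_le_of_ne h1 fun h' => hζ (this.1 h'.symm)
  have hr := Real.sqrt_pos.2 h0
  have hrr := Real.mul_self_sqrt h0.le
  set r := √(ζ ⬝ᵥ ζ)
  set e := r⁻¹ • ζ with he
  have hee : e ⬝ᵥ e = 1 := by
    rw [he, smul_dotProduct, dotProduct_smul, smul_eq_mul, smul_eq_mul]
    field_simp
    rw [sq, hrr]
  have hζe : ζ = r • e := by rw [he, smul_smul, mul_inv_cancel₀ hr.ne', one_smul]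
  have hze : ζ ⬝ᵥ e = r := by
    conv_lhs => rw [hζe]
    rw [smul_dotProduct, hee]; simp
  have main : ∀ z : ℂ, z ∈ ({(r : ℂ), -(r : ℂ)} : Set ℂ)ᶜ →
      (∀ i : Fin n, φ 0 0 i.succ z = 0) ∧
      (∀ i j : Fin n, i ≠ j → φ 0 i.succ j.succ z = 0) ∧
      (∀ i : Fin n, (c : ℂ) ^ 2 * φ 0 0 0 z + φ 0 i.succ i.succ z = 0) := by
    intro z hz
    have hrC : (r : ℂ) ≠ 0 := by exact_mod_cast hr.ne'
    obtain ⟨θ, hθ⟩ := Complex.cos_surjective (z / r)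
    have hzθ : Complex.cos θ * r = z := by rw [hθ]; field_simp
    have hS : Complex.sin θ ≠ 0 := by
      intro hS
      have h1 := Complex.cos_sq_add_sin_sq θ
      rw [hS] at h1
      have h2 : (Complex.cos θ - 1) * (Complex.cos θ + 1) = 0 := by linear_combination h1
      apply hz
      rcases mul_eq_zero.1 h2 with h3 | h3
      · left; linear_combination -hzθ + r * h3
      · right; show z = _; linear_combination -hzθ + r * h3
    set M : Fin (n + 1) → Fin (n + 1) → ℂ := fun i j => φ 0 i j z with hM
    have hMs : ∀ i j, M i j = M j i := fun i j => by simp only [M]; rw [hsym]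
    have cs : ∀ v : Fin n → ℝ, v ⬝ᵥ v = 1 → e ⬝ᵥ v = 0 →
        bf M (tmv n) (spv e) = 0 ∧ bf M (tmv n) (spv v) = 0 ∧ bf M (spv e) (spv v) = 0 ∧
        bf M (spv e) (spv e) = bf M (spv v) (spv v) ∧
        (c : ℂ) ^ 2 * bf M (tmv n) (tmv n) = - bf M (spv e) (spv e) := by
      intro v hv hev
      have := circle_struct hc hφ hsym ζ h hee hv hev
        (by rw [hζe, smul_dotProduct, hev, smul_zero]) θ hS
      rw [hze, hzθ] at this
      exact this
    have gen : ∀ a : Fin n → ℝ, bf M (tmv n) (spv a) = 0 ∧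
        bf M (spv a) (spv a) = ((a ⬝ᵥ a : ℝ) : ℂ) * bf M (spv e) (spv e) ∧
        (c : ℂ) ^ 2 * bf M (tmv n) (tmv n) = - bf M (spv e) (spv e) := by
      intro a
      obtain ⟨v, α, β, hv, hev, rfl⟩ := exists_decomp hn e hee a
      obtain ⟨c1, c2, c3, c4, c5⟩ := cs v hv hev
      have c6 := bf_symm hMs (spv v) (spv e)
      have hd : (α • e + β • v) ⬝ᵥ (α • e + β • v) = α * α + β * β := by
        simp only [add_dotProduct, dotProduct_add, smul_dotProduct, dotProduct_smul, smul_eq_mul,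
          hee, hv, hev, dotProduct_comm v e]
        ring
      refine ⟨?_, ?_, c5⟩
      · simp only [spv_comb, bf_add_right, bf_smul_right, c1, c2, mul_zero, add_zero]
      · rw [hd]
        simp only [spv_comb, bf_add_left, bf_add_right, bf_smul_left, bf_smul_right, c6, c3, ← c4]
        push_cast
        ring
    refine ⟨fun i => ?_, fun i j hij => ?_, fun i => ?_⟩
    · have := (gen (Pi.single i 1)).1
      rwa [tmv_single, spv_single, bf_single] at this
    · have h1 := (gen ((1 : ℝ) • Pi.single i 1 + (1 : ℝ) • Pi.single j 1)).2.1
      have h2 := (gen (Pi.single i 1)).2.1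
      have h3 := (gen (Pi.single j 1)).2.1
      rw [spv_comb] at h1
      simp only [bf_add_left, bf_add_right, bf_smul_left, bf_smul_right, spv_single, bf_single,
        one_smul] at h1 h2 h3
      have h4 := hMs i.succ j.succ
      simp [add_dotProduct, dotProduct_add, hij, hij.symm] at h1 h2 h3
      show M i.succ j.succ = 0
      linear_combination (h1 - h2 - h3 + h4) / 2
    · have h1 := (gen (Pi.single i 1)).2
      rw [tmv_single, spv_single, bf_single, bf_single] at h1
      simp at h1
      show (c : ℂ) ^ 2 * M 0 0 + M i.succ i.succ = 0
      rw [h1.1, h1.2]; ring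
  have hdense : Dense (({(r : ℂ), -(r : ℂ)} : Set ℂ)ᶜ) :=
    (Set.toFinite _).countable.dense_compl ℂ
  have hcont : ∀ i j, Continuous (φ 0 i j) := fun i j =>
    continuous_iff_continuousAt.2 fun z => (hφ 0 i j z).continuousAt
  refine ⟨fun i => ?_, fun i j hij => ?_, fun i => ?_⟩
  · exact congrFun (Continuous.ext_on hdense (hcont _ _) continuous_const
      (g := fun _ => (0 : ℂ)) fun z hz => (main z hz).1 i) z
  · exact congrFun (Continuous.ext_on hdense (hcont _ _) continuous_const
      (g := fun _ => (0 : ℂ)) fun z hz => (main z hz).2.1 i j hij) z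
  · exact congrFun (Continuous.ext_on hdense
      ((continuous_const.mul (hcont 0 0)).add (hcont i.succ i.succ)) continuous_const
      (g := fun _ => (0 : ℂ)) fun z hz => (main z hz).2.2 i) z

/-- The tensor field is a multiple of the Minkowski metric. -/
theorem tensor_struct
    (n : ℕ) (hn : 2 ≤ n) (c : ℝ) (hc : 0 < c)
    (ω₀ : Fin n → ℝ) (hω₀ : onSphere n ω₀) (δ : ℝ) (hδ : 0 < δ)
    (f : Fin (n + 1) → Fin (n + 1) → (Fin (n + 1) → ℝ) → ℂ)
    (hsym : ∀ i j, f i j = f j i)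
    (hcont : ∀ i j, Continuous (f i j)) (hsupp : ∀ i j, HasCompactSupport (f i j))
    (h : ∀ k ≤ 2, ∀ (x : Fin (n + 1) → ℝ) (ω : Fin n → ℝ), inBall n ω₀ δ ω →
      lrt2 n c k f x ω = 0) :
    (∀ i : Fin n, f 0 i.succ = 0) ∧
    (∀ i j : Fin n, i ≠ j → f i.succ j.succ = 0) ∧
    (∀ i : Fin n, (fun x => (c : ℂ) ^ 2 * f 0 0 x + f i.succ i.succ x) = 0) := by
  have hac : ∀ i j ζ, Continuous (pft n c (f i j) ζ) := fun i j ζ =>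
    (pft_cont (hcont i j) (hsupp i j)).comp (by fun_prop : Continuous fun s : ℝ => (ζ, s))
  have has : ∀ i j ζ, HasCompactSupport (pft n c (f i j) ζ) := fun i j ζ => pft_supp hc (hsupp i j) ζ
  have hd : ∀ ζ k i j z, HasDerivAt (fl k (pft n c (f i j) ζ))
      (Complex.I * fl (k + 1) (pft n c (f i j) ζ) z) z := fun ζ k i j z =>
    fl_deriv (hac i j ζ) (has i j ζ) k z
  have hball : ∀ ζ, ∀ k ≤ 2, ∀ ω, inBall n ω₀ δ ω →
      bf (fun i j => fl k (pft n c (f i j) ζ) ((ζ ⬝ᵥ ω : ℝ) : ℂ))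
        (fun i => (ld n c ω i : ℂ)) (fun i => (ld n c ω i : ℂ)) = 0 := by
    intro ζ k hk ω hω
    have h1 : ∫ y : Fin n → ℝ, Complex.exp (-Complex.I * ((ζ ⬝ᵥ y : ℝ) : ℂ)) *
        lrt2 n c k f (Fin.cons 0 y) ω = 0 := by
      simp [h k hk _ ω hω]
    rw [← h1]
    unfold lrt2 bf
    simp only [Finset.mul_sum]
    have hIntg : ∀ i j, Integrable fun y : Fin n → ℝ =>
        Complex.exp (-Complex.I * ((ζ ⬝ᵥ y : ℝ) : ℂ)) *
        ((ld n c ω i : ℂ) * (ld n c ω j : ℂ) *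
        ∫ s : ℝ, (s : ℂ) ^ k * f i j (Fin.cons 0 y + s • ld n c ω)) := by
      intro i j
      have := (slice_integrable hc (hcont i j) (hsupp i j) k ζ ω).const_mul
        ((ld n c ω i : ℂ) * (ld n c ω j : ℂ))
      refine this.congr (Filter.Eventually.of_forall fun y => ?_)
      ring
    rw [integral_finsetSum _ fun i _ => integrable_finsetSum _ fun j _ => hIntg i j]
    refine Finset.sum_congr rfl fun i _ => ?_
    rw [integral_finsetSum _ fun j _ => hIntg i j]
    refine Finset.sum_congr rfl fun j _ => ?_
    rw [← slice hc (hcont i j) (hsupp i j), ← integral_const_mul]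
    congr 1
    ext y
    ring
  have key := fun (ζ : Fin n → ℝ) (hζ : ζ ≠ 0) => core hn hc
    (φ := fun k i j => fl k (pft n c (f i j) ζ)) (hd ζ) (fun k i j => by simp only [hsym i j]) ζ hζ
    (fun k hk ω hω => to_sphere hn (hd ζ k) ζ ω₀ δ hω₀ hδ (hball ζ k hk) ω hω)
  refine ⟨fun i => ?_, fun i j hij => ?_, fun i => ?_⟩
  · exact pft_inj hn hc (hcont _ _) (hsupp _ _) fun ζ hζ σ => (key ζ hζ σ).1 i
  · exact pft_inj hn hc (hcont _ _) (hsupp _ _) fun ζ hζ σ => (key ζ hζ σ).2.1 i j hij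
  · refine pft_inj hn hc (by fun_prop) ((hsupp 0 0).mul_left.add (hsupp _ _)) fun ζ hζ σ => ?_
    rw [← (key ζ hζ σ).2.2 i]
    have h1 : pft n c (fun x => (c : ℂ) ^ 2 * f 0 0 x + f i.succ i.succ x) ζ =
        fun s => (c : ℂ) ^ 2 * pft n c (f 0 0) ζ s + pft n c (f i.succ i.succ) ζ s := by
      ext s
      unfold pft
      rw [← integral_const_mul, ← integral_add]
      · congr 1
        ext y
        ring
      · exact (pft_integrable (hcont 0 0) (hsupp 0 0) ζ s).const_mul _
      · exact pft_integrable (hcont _ _) (hsupp _ _) ζ s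
    rw [h1]
    unfold fl
    rw [← integral_const_mul, ← integral_add]
    · congr 1
      ext s
      ring
    · exact (fl_integrable (hac 0 0 ζ) (has 0 0 ζ) 0 σ).const_mul _
    · exact fl_integrable (hac _ _ ζ) (has _ _ ζ) 0 σ

/-- If `L̃^{2,k} f` vanishes on `B_n(ω₀, δ)` for `k = 0,1,2`, then for
`k = 0,1` and all base points and `ω ∈ B_n(ω₀, δ)`:
`Σ_{i=1}^n L̃^{0,k}(f_{ii}) − Σ_{i,j=1}^n ω_i ω_j L̃^{0,k}(f_{ij}) = c(1−n) · L̃^{1,k}((f)_0)`. -/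
theorem two_tensor_trace_relation
    (n : ℕ) (hn : 2 ≤ n) (c : ℝ) (hc : 0 < c)
    (ω₀ : Fin n → ℝ) (hω₀ : onSphere n ω₀) (δ : ℝ) (hδ : 0 < δ)
    (f : Fin (n + 1) → Fin (n + 1) → (Fin (n + 1) → ℝ) → ℂ)
    (hsym : ∀ i j, f i j = f j i)
    (hreg : ∀ i j, ContDiff ℝ (⊤ : ℕ∞) (f i j) ∧ HasCompactSupport (f i j))
    (h : ∀ k ≤ 2, ∀ (x : Fin (n + 1) → ℝ) (ω : Fin n → ℝ), inBall n ω₀ δ ω →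
      lrt2 n c k f x ω = 0) :
    ∀ k ≤ 1, ∀ (x : Fin (n + 1) → ℝ) (ω : Fin n → ℝ), inBall n ω₀ δ ω →
      (∑ i : Fin n, lrtSc n c k (f i.succ i.succ) x ω)
        - ∑ i : Fin n, ∑ j : Fin n, ((ω i * ω j : ℝ) : ℂ) *
            lrtSc n c k (f i.succ j.succ) x ω
      = ((c * (1 - (n : ℝ)) : ℝ) : ℂ) * lrtVec n c k (fun j => f j 0) x ω := by
  obtain ⟨s1, s2, s3⟩ := tensor_struct n hn c hc ω₀ hω₀ δ hδ f hsym
    (fun i j => (hreg i j).1.continuous) (fun i j => (hreg i j).2) h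
  intro k _ x ω hω
  set J : ℂ := ∫ s : ℝ, (s : ℂ) ^ k * f 0 0 (x + s • ld n c ω) with hJ
  have d1 : ∀ i : Fin n, lrtSc n c k (f i.succ i.succ) x ω = -(c : ℂ) ^ 2 * J := by
    intro i
    unfold lrtSc
    rw [hJ, ← integral_const_mul]
    congr 1
    ext s
    have := congrFun (s3 i) (x + s • ld n c ω)
    simp only [Pi.zero_apply] at this
    linear_combination (s : ℂ) ^ k * this
  have d2 : ∀ i j : Fin n, i ≠ j → lrtSc n c k (f i.succ j.succ) x ω = 0 := by
    intro i j hij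
    simp [lrtSc, s2 i j hij]
  have d3 : lrtVec n c k (fun j => f j 0) x ω = c * J := by
    unfold lrtVec
    rw [Fin.sum_univ_succ, Finset.sum_eq_zero, add_zero]
    · simp [ld, hJ]
    · intro i _
      simp [hsym i.succ 0, s1 i]
  have d4 : ∑ i : Fin n, ∑ j : Fin n, ((ω i * ω j : ℝ) : ℂ) *
      lrtSc n c k (f i.succ j.succ) x ω = -(c : ℂ) ^ 2 * J := by
    have h1 : ∀ i : Fin n, ∑ j : Fin n, ((ω i * ω j : ℝ) : ℂ) *
        lrtSc n c k (f i.succ j.succ) x ω = ((ω i ^ 2 : ℝ) : ℂ) * (-(c : ℂ) ^ 2 * J) := by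
      intro i
      rw [Finset.sum_eq_single i, d1, sq (ω i)]
      · intro j _ hj
        rw [d2 i j hj.symm, mul_zero]
      · simp
    simp only [h1]
    rw [← Finset.sum_mul, ← Complex.ofReal_sum, hω.1]
    simp
  rw [d3, d4, Finset.sum_congr rfl fun i _ => d1 i, Finset.sum_const]
  simp only [Finset.card_univ, Fintype.card_fin, nsmul_eq_mul]
  push_cast
  ring
end
end
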